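/- arXiv:1407.8009 — 2 statements merged into one kernel-verified Lean document; each statement's English description precedes it below -/
import Mathlib

section
/- For μ, ν ∈ M the following are equivalent: (i) μ ≤_{C,sto} ν; (ii) there exists η ∈ M with μ ≤_sto η and η ≤_C ν; (iii) there exists η′ ∈ M with μ ≤_C η′ and η′ ≤_sto ν. (Instance of the chain-of-relations theorem: the combined order ≤_{C,sto} decomposes, in either order, into a stochastic-order step and a convex-order step.) -/
open MeasureTheory Set Filter ProbabilityTheory

noncomputable section

/-- A function has at most linear growth. -/
def LinGrowth (φ : ℝ → ℝ) : Prop := ∃ C : ℝ, ∀ x : ℝ, |φ x| ≤ C * (1 + |x|)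

/-- Membership in `M`: finite positive Borel measure on `ℝ` with finite first moment. -/
def MemM (μ : Measure ℝ) : Prop := IsFiniteMeasure μ ∧ Integrable (fun x => x) μ

/-- Stochastic order `≤_sto`. -/
def leSto (μ ν : Measure ℝ) : Prop :=
  ∀ φ : ℝ → ℝ, LinGrowth φ → Monotone φ → ∫ x, φ x ∂μ ≤ ∫ x, φ x ∂ν

/-- Convex order `≤_C`. -/
def leC (μ ν : Measure ℝ) : Prop :=
  ∀ φ : ℝ → ℝ, LinGrowth φ → ConvexOn ℝ Set.univ φ → ∫ x, φ x ∂μ ≤ ∫ x, φ x ∂ν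

/-- Order `≤_{C,+}` (extended order). -/
def leCP (μ ν : Measure ℝ) : Prop :=
  ∀ φ : ℝ → ℝ, LinGrowth φ → ConvexOn ℝ Set.univ φ → (∀ x, 0 ≤ φ x) →
    ∫ x, φ x ∂μ ≤ ∫ x, φ x ∂ν

/-- Order `≤_{sto,+}`. -/
def leStoP (μ ν : Measure ℝ) : Prop :=
  ∀ φ : ℝ → ℝ, LinGrowth φ → Monotone φ → (∀ x, 0 ≤ φ x) →
    ∫ x, φ x ∂μ ≤ ∫ x, φ x ∂ν

/-- Order `≤_{C,sto}`. -/
def leCS (μ ν : Measure ℝ) : Prop :=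
  ∀ φ : ℝ → ℝ, LinGrowth φ → ConvexOn ℝ Set.univ φ → Monotone φ →
    ∫ x, φ x ∂μ ≤ ∫ x, φ x ∂ν

/-- Order `≤_{C,+,sto}`. -/
def leCPS (μ ν : Measure ℝ) : Prop :=
  ∀ φ : ℝ → ℝ, LinGrowth φ → ConvexOn ℝ Set.univ φ → (∀ x, 0 ≤ φ x) → Monotone φ →
    ∫ x, φ x ∂μ ≤ ∫ x, φ x ∂ν

/-- The Kantorovich distance. -/
def W (μ ν : Measure ℝ) : ℝ :=
  sSup {d : ℝ | ∃ f : ℝ → ℝ, LipschitzWith 1 f ∧ d = |∫ x, f x ∂μ - ∫ x, f x ∂ν|}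

/-- Quantile function `G_ν`. -/
def quantile (ν : Measure ℝ) (t : ℝ) : ℝ := sInf {x : ℝ | t ≤ (ν (Set.Iic x)).toReal}

/-- `IsShadow μ ν η` means `η = S^ν(μ)`, the shadow of `μ` in `ν`. -/
def IsShadow (μ ν η : Measure ℝ) : Prop :=
  leC μ η ∧ η ≤ ν ∧ ∀ η' : Measure ℝ, leC μ η' → η' ≤ ν → leC η η'

/-- `Top(μ,ν)`: pushforward of Lebesgue measure on `(0, m]` by `max (G_μ) (G_ν)`. -/
def TopMeas (μ ν : Measure ℝ) : Measure ℝ :=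
  Measure.map (fun t => max (quantile μ t) (quantile ν t))
    (volume.restrict (Set.Ioc (0:ℝ) (μ Set.univ).toReal))

/-- `Down(μ,ν)`: pushforward of Lebesgue measure on `(0, m]` by `min (G_μ) (G_ν)`. -/
def DownMeas (μ ν : Measure ℝ) : Measure ℝ :=
  Measure.map (fun t => min (quantile μ t) (quantile ν t))
    (volume.restrict (Set.Ioc (0:ℝ) (μ Set.univ).toReal))

/-- Support of a measure on a topological space. -/
def mSupport {α : Type*} [TopologicalSpace α] [MeasurableSpace α] (μ : Measure α) : Set α :=
  {x | ∀ U ∈ nhds x, μ U ≠ 0}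

/-- Positive part (Jordan decomposition) of the signed measure `η - μ`. -/
def posPartSub (η μ : Measure ℝ) [IsFiniteMeasure η] [IsFiniteMeasure μ] : Measure ℝ :=
  (η.toSignedMeasure - μ.toSignedMeasure).toJordanDecomposition.posPart

/-- `π` is a martingale coupling of `μ` and `ν`. -/
def IsMartCoupling (π : Measure (ℝ × ℝ)) (μ ν : Measure ℝ) : Prop :=
  IsProbabilityMeasure π ∧ π.fst = μ ∧ π.snd = ν ∧
    ∀ f : ℝ → ℝ, Continuous f → (∃ C : ℝ, ∀ x, |f x| ≤ C) →
      ∫ p : ℝ × ℝ, f p.1 * (p.2 - p.1) ∂π = 0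

/-- A coupling is left-monotone. -/
def LeftMonotone (π : Measure (ℝ × ℝ)) : Prop :=
  ∃ Γ : Set (ℝ × ℝ), MeasurableSet Γ ∧ π Γ = 1 ∧
    ∀ x ym yp x' y' : ℝ, (x, ym) ∈ Γ → (x, yp) ∈ Γ → (x', y') ∈ Γ →
      x < x' → ym < yp → y' ∉ Set.Ioo ym yp

/-- The set `A` of points `x` with `π((-∞,x) × (x,∞)) = 0`. -/
def jumpSet (π : Measure (ℝ × ℝ)) : Set ℝ := {x | π (Set.Iio x ×ˢ Set.Ioi x) = 0}

/-- The set `A⁻` of points of `A` isolated on the right in `A`. -/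
def jumpSetMinus (π : Measure (ℝ × ℝ)) : Set ℝ :=
  {x ∈ jumpSet π | ∃ ε > 0, Set.Ioo x (x + ε) ∩ jumpSet π = ∅}

/-- Normalised fiber measure `π_x`. -/
def fiberMeasure (π : Measure (ℝ × ℝ)) (x : ℝ) : Measure ℝ :=
  (π.fst {x})⁻¹ • Measure.snd (π.restrict ({x} ×ˢ Set.univ))

/-- The reduced support `spt* π`. -/
def sptStar (π : Measure (ℝ × ℝ)) : Set (ℝ × ℝ) :=
  (mSupport π \ (jumpSetMinus π ×ˢ (Set.univ : Set ℝ))) ∪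
    ⋃ x ∈ {x : ℝ | 0 < π.fst {x}}, {x} ×ˢ mSupport (fiberMeasure π x)


/-- A finite measure on `ℝ` of mass `m` is the image of Lebesgue measure on `(0, m)` under a
nondecreasing map. -/
lemma exists_monotoneOn_map_volume_eq (μ : Measure ℝ) [IsFiniteMeasure μ] :
    ∃ G : ℝ → ℝ, MonotoneOn G (Ioo 0 (μ.real univ)) ∧
      Measure.map G (volume.restrict (Ioo 0 (μ.real univ))) = μ := by
  set m := μ.real univ with hm
  set F : ℝ → ℝ := fun x => μ.real (Iic x) with hF
  have hFm : Monotone F := fun x y hxy => measureReal_mono (Iic_subset_Iic.2 hxy)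
  have hFbot : Tendsto F atBot (nhds 0) := by
    have h := tendsto_measure_iInter_atBot (μ := μ) (s := fun x : ℝ => Iic x)
      (fun i => nullMeasurableSet_Iic) (fun i j hij => Iic_subset_Iic.2 hij)
      ⟨0, measure_ne_top _ _⟩
    rw [iInter_Iic_eq_empty_iff.2 (by simp), measure_empty] at h
    exact (ENNReal.tendsto_toReal ENNReal.zero_ne_top).comp h
  have hFtop : Tendsto F atTop (nhds m) :=
    (ENNReal.tendsto_toReal (measure_ne_top μ univ)).comp (tendsto_measure_Iic_atTop μ)
  have hFright : ∀ x t : ℝ, (∀ y > x, t ≤ F y) → t ≤ F x := by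
    intro x t h
    have h1 := tendsto_measure_biInter_gt (μ := μ) (s := fun y : ℝ => Iic y) (a := x)
      (fun i _ => nullMeasurableSet_Iic) (fun i j _ hij => Iic_subset_Iic.2 hij)
      ⟨x + 1, by simp, measure_ne_top _ _⟩
    have h2 : (⋂ r > x, Iic r) = Iic x := by
      ext z
      simp only [mem_iInter, mem_Iic]
      exact ⟨fun hz => le_of_forall_gt_imp_ge_of_dense hz, fun hz r hr => hz.trans hr.le⟩
    rw [h2] at h1
    have h3 := (ENNReal.tendsto_toReal (measure_ne_top μ (Iic x))).comp h1
    exact ge_of_tendsto h3 (eventually_nhdsWithin_of_forall fun y hy => h y hy)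
  set G : ℝ → ℝ := fun t => sInf {x | t ≤ F x} with hG
  have hne : ∀ t ∈ Ioo 0 m, {x | t ≤ F x}.Nonempty := fun t ht =>
    (hFtop.eventually (lt_mem_nhds ht.2)).exists.imp fun x hx => hx.le
  have hbdd : ∀ t ∈ Ioo 0 m, BddBelow {x | t ≤ F x} := by
    intro t ht
    obtain ⟨z, hz⟩ := (hFbot.eventually (gt_mem_nhds ht.1)).exists
    refine ⟨z, fun x hx => ?_⟩
    by_contra! hxz
    exact absurd (hFm hxz.le) (not_le.2 (hz.trans_le hx))
  have key : ∀ t ∈ Ioo 0 m, ∀ x, G t ≤ x ↔ t ≤ F x := by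
    intro t ht x
    refine ⟨fun h => hFright x t fun y hy => ?_, fun h => csInf_le (hbdd t ht) h⟩
    obtain ⟨z, hz, hzy⟩ := exists_lt_of_csInf_lt (hne t ht) (h.trans_lt hy)
    exact le_trans hz (hFm hzy.le)
  have hmono : MonotoneOn G (Ioo 0 m) := fun s hs t ht hst =>
    (key s hs _).2 (hst.trans ((key t ht _).1 le_rfl))
  refine ⟨G, hmono, ?_⟩
  have hae : AEMeasurable G (volume.restrict (Ioo 0 m)) :=
    aemeasurable_restrict_of_monotoneOn measurableSet_Ioo hmono
  have : IsFiniteMeasure (Measure.map G (volume.restrict (Ioo 0 m))) := inferInstance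
  refine Measure.ext_of_Iic _ _ fun x => ?_
  rw [Measure.map_apply_of_aemeasurable hae measurableSet_Iic]
  have hFx : F x ≤ m := measureReal_mono (subset_univ _)
  have hset : G ⁻¹' Iic x ∩ Ioo 0 m = Ioo 0 m ∩ Iic (F x) := by
    ext t
    simp only [mem_inter_iff, mem_preimage, mem_Iic]
    exact ⟨fun h => ⟨h.2, (key t h.2 x).1 h.1⟩, fun h => ⟨(key t h.1 x).2 h.2, h.1⟩⟩
  rw [Measure.restrict_apply₀' measurableSet_Ioo.nullMeasurableSet, hset]
  have hF0 : ENNReal.ofReal (F x) = μ (Iic x) := ENNReal.ofReal_toReal (measure_ne_top _ _)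
  rw [← hF0]
  apply le_antisymm
  · have hsub : Ioo 0 m ∩ Iic (F x) ⊆ Ioc 0 (F x) := fun t ht => ⟨ht.1.1, ht.2⟩
    simpa using measure_mono (μ := volume) hsub
  · have hsub : Ioo 0 (F x) ⊆ Ioo 0 m ∩ Iic (F x) :=
      fun t ht => ⟨⟨ht.1, ht.2.trans_le hFx⟩, ht.2.le⟩
    simpa using measure_mono (μ := volume) hsub

/-- A convex function of linear growth on `ℝ` has a bounded nondecreasing subgradient. -/
lemma ConvexOn.exists_monotone_subgradient {φ : ℝ → ℝ} (hc : ConvexOn ℝ univ φ)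
    (hφ : LinGrowth φ) :
    ∃ s : ℝ → ℝ, Monotone s ∧ (∃ C, ∀ x, |s x| ≤ C) ∧
      ∀ x y, φ x + s x * (y - x) ≤ φ y := by
  set s : ℝ → ℝ := fun x => derivWithin φ (Ioi x) x
  have hs : ∀ x y, φ x + s x * (y - x) ≤ φ y := by
    intro x y
    rcases lt_trichotomy x y with h | rfl | h
    · have := hc.rightDeriv_le_slope_of_mem_interior (x := x) (y := y) (by simp) (mem_univ _) h
      rw [slope_def_field, le_div_iff₀ (sub_pos.2 h)] at this
      linarith
    · simp
    · have h1 := hc.slope_le_leftDeriv_of_mem_interior (x := y) (y := x) (mem_univ _) (by simp) h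
      have h2 := h1.trans (hc.leftDeriv_le_rightDeriv_of_mem_interior (x := x) (by simp))
      rw [slope_def_field, div_le_iff₀ (sub_pos.2 h)] at h2
      have : s x * (y - x) = -(s x * (x - y)) := by ring
      rw [this]
      linarith
  refine ⟨s, ?_, ?_, hs⟩
  · intro x y hxy
    exact hc.monotoneOn_rightDeriv (by simp) (by simp) hxy
  · obtain ⟨C, hC⟩ := hφ
    have hlim : ∀ x ε : ℝ, ε = 1 ∨ ε = -1 → ε * s x ≤ C := by
      intro x ε hε
      by_contra! hlt
      have hbd : ∀ r : ℝ, 0 ≤ r → (ε * s x - C) * r ≤ C * (1 + |x|) - φ x := by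
        intro r hr
        have h1 := hs x (x + ε * r)
        have h2 := (le_abs_self _).trans (hC (x + ε * r))
        have hC0 : 0 ≤ C := by
          have := (abs_nonneg _).trans (hC 0)
          simpa using this
        have h3 : |x + ε * r| ≤ |x| + r := by
          refine (abs_add_le _ _).trans ?_
          rcases hε with rfl | rfl <;> simp [abs_of_nonneg hr]
        have h4 := mul_le_mul_of_nonneg_left h3 hC0
        nlinarith
      have hd : 0 < ε * s x - C := by linarith
      have hnn : 0 ≤ C * (1 + |x|) - φ x := by simpa using hbd 0 le_rfl
      have := hbd ((C * (1 + |x|) - φ x) / (ε * s x - C) + 1) (by positivity)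
      rw [mul_add, mul_div_cancel₀ _ hd.ne'] at this
      linarith
    refine ⟨C, fun x => abs_le.2 ⟨?_, ?_⟩⟩
    · linarith [hlim x (-1) (Or.inr rfl)]
    · linarith [hlim x 1 (Or.inl rfl)]

lemma LinGrowth.integrable {φ : ℝ → ℝ} (hφ : LinGrowth φ) (hm : Measurable φ) {μ : Measure ℝ}
    (hμ : MemM μ) : Integrable φ μ := by
  obtain ⟨C, hC⟩ := hφ
  have := hμ.1
  refine Integrable.mono' (((integrable_const (1 : ℝ)).add hμ.2.abs).const_mul C)
    hm.aestronglyMeasurable (Eventually.of_forall fun x => ?_)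
  simpa using hC x

lemma ConvexOn.measurable_of_univ {φ : ℝ → ℝ} (hc : ConvexOn ℝ univ φ) : Measurable φ :=
  (continuousOn_univ.1 (hc.continuousOn isOpen_univ)).measurable

/-- If `w` has nonnegative tail integrals on `(0, m)` and total integral zero, then its integral
against any bounded nondecreasing function is nonnegative. -/
lemma integral_mul_nonneg_of_tail_nonneg {m : ℝ} {w s : ℝ → ℝ}
    (hw : IntegrableOn w (Ioo 0 m)) (htail : ∀ t ∈ Icc 0 m, 0 ≤ ∫ r in Ioo t m, w r)
    (hzero : ∫ r in Ioo 0 m, w r = 0) (hs : MonotoneOn s (Ioo 0 m)) {C : ℝ}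
    (hC : ∀ t, |s t| ≤ C) : 0 ≤ ∫ t in Ioo 0 m, s t * w t := by
  have hlevel : ∀ c : ℝ, 0 ≤ ∫ t in Ioo 0 m, {t | c < s t}.indicator w t := by
    intro c
    set A : Set ℝ := {t | t ∈ Ioo 0 m ∧ c < s t} with hA
    rcases A.eq_empty_or_nonempty with hAe | hAne
    · refine (setIntegral_congr_fun measurableSet_Ioo fun t ht => ?_).trans
        (integral_zero _ _) |>.ge
      refine indicator_of_notMem (fun h => ?_) _
      exact (hAe ▸ (⟨ht, h⟩ : t ∈ A) : t ∈ (∅ : Set ℝ))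
    · have hbdd : BddBelow A := ⟨0, fun t ht => ht.1.1.le⟩
      have h0 : 0 ≤ sInf A := le_csInf hAne fun t ht => ht.1.1.le
      have hm : sInf A ≤ m := by
        obtain ⟨t, ht⟩ := hAne
        exact (csInf_le hbdd ht).trans ht.1.2.le
      have hup : ∀ t ∈ Ioo (sInf A) m, c < s t := by
        intro t ht
        obtain ⟨r, hr, hrt⟩ := exists_lt_of_csInf_lt hAne ht.1
        exact lt_of_lt_of_le hr.2 (hs hr.1 ⟨hr.1.1.trans hrt, ht.2⟩ hrt.le)
      have hae : ∀ᵐ t ∂(volume.restrict (Ioo 0 m)),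
          {t | c < s t}.indicator w t = (Ioo (sInf A) m).indicator w t := by
        filter_upwards [ae_restrict_mem measurableSet_Ioo,
          ae_restrict_of_ae (Measure.ae_ne volume (sInf A))] with t ht hne
        by_cases hct : c < s t
        · have : sInf A < t := lt_of_le_of_ne (csInf_le hbdd ⟨ht, hct⟩) hne.symm
          rw [indicator_of_mem (show t ∈ {t | c < s t} from hct),
            indicator_of_mem (show t ∈ Ioo (sInf A) m from ⟨this, ht.2⟩)]
        · rw [indicator_of_notMem (show t ∉ {t | c < s t} from hct),
            indicator_of_notMem fun h => hct (hup t h)]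
      rw [integral_congr_ae hae, setIntegral_indicator measurableSet_Ioo,
        inter_eq_right.2 (Ioo_subset_Ioo_left h0)]
      exact htail _ ⟨h0, hm⟩
  obtain ⟨s', hs', hss'⟩ := hs.exists_monotone_extension
    ⟨-C, by rintro _ ⟨t, -, rfl⟩; exact (abs_le.1 (hC t)).1⟩
    ⟨C, by rintro _ ⟨t, -, rfl⟩; exact (abs_le.1 (hC t)).2⟩
  set E : Set (ℝ × ℝ) := {p | p.2 < s' p.1} with hE
  have hEm : MeasurableSet E :=
    measurableSet_lt measurable_snd (hs'.measurable.comp measurable_fst)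
  have hint : Integrable (E.indicator fun p : ℝ × ℝ => w p.1)
      ((volume.restrict (Ioo 0 m)).prod (volume.restrict (Ioc (-C) C))) := by
    refine Integrable.indicator ?_ hEm
    exact Integrable.comp_fst hw _
  have hswap := integral_integral_swap (f := fun t c => E.indicator (fun p : ℝ × ℝ => w p.1) (t, c))
    hint
  have hinner : ∀ t ∈ Ioo 0 m,
      ∫ c in Ioc (-C) C, E.indicator (fun p : ℝ × ℝ => w p.1) (t, c) = s t * w t + C * w t := by
    intro t ht
    have hb := abs_le.1 (hC t)
    have : (fun c => E.indicator (fun p : ℝ × ℝ => w p.1) (t, c))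
        = (Iio (s t)).indicator fun _ => w t := by
      ext c
      simp only [indicator, hE, mem_ofPred_eq, mem_Iio, hss' ht]
    rw [this, setIntegral_indicator measurableSet_Iio]
    have hset : Ioc (-C) C ∩ Iio (s t) = Ioo (-C) (s t) := by
      ext c
      simp only [mem_inter_iff, mem_Ioc, mem_Iio, mem_Ioo]
      exact ⟨fun h => ⟨h.1.1, h.2⟩, fun h => ⟨⟨h.1, h.2.le.trans hb.2⟩, h.2⟩⟩
    rw [hset, setIntegral_const, Real.volume_real_Ioo_of_le hb.1, smul_eq_mul]
    ring
  have hsw : IntegrableOn (fun t => s t * w t) (Ioo 0 m) := by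
    refine Integrable.bdd_mul hw
      (aemeasurable_restrict_of_monotoneOn measurableSet_Ioo hs).aestronglyMeasurable
      (c := C) (Eventually.of_forall hC)
  have hleft : ∫ t in Ioo 0 m, ∫ c in Ioc (-C) C, E.indicator (fun p : ℝ × ℝ => w p.1) (t, c)
      = ∫ t in Ioo 0 m, s t * w t := by
    rw [setIntegral_congr_fun measurableSet_Ioo hinner, integral_add hsw (hw.const_mul C),
      integral_const_mul, hzero, mul_zero, add_zero]
  rw [← hleft, hswap]
  refine integral_nonneg fun c => ?_
  refine (hlevel c).trans_eq (setIntegral_congr_fun measurableSet_Ioo fun t ht => ?_)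
  simp only [indicator, hE, mem_ofPred_eq, hss' ht]

/-- If `u` has nonnegative tail integrals on `[0, m]`, there is a nonnegative function with the
same total integral and smaller tail integrals: minus the derivative of the running infimum of the
tail integral of `u`. -/
lemma exists_nonneg_tail_le {m : ℝ} (hm : 0 ≤ m) {u : ℝ → ℝ}
    (hu : IntervalIntegrable u volume 0 m) (htail : ∀ t ∈ Icc 0 m, 0 ≤ ∫ r in t..m, u r) :
    ∃ h : ℝ → ℝ, IntervalIntegrable h volume 0 m ∧ (∀ t ∈ Ioo 0 m, 0 ≤ h t) ∧
      (∀ t ∈ Icc 0 m, ∫ r in t..m, h r ≤ ∫ r in t..m, u r) ∧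
      ∫ r in 0..m, h r = ∫ r in 0..m, u r := by
  set ψ : ℝ → ℝ := fun t => ∫ r in t..m, u r with hψ
  set L : ℝ → ℝ := fun t => ∫ r in 0..t, |u r| with hL
  set H : ℝ → ℝ := fun t => sInf (ψ '' Icc 0 t) with hH
  have hsub : ∀ {a b}, a ∈ Icc 0 m → b ∈ Icc 0 m → IntervalIntegrable u volume a b := by
    intro a b ha hb
    refine hu.mono_set ?_
    rw [uIcc_of_le hm]
    exact ordConnected_Icc.uIcc_subset ha hb
  have hbdd : ∀ t ∈ Icc 0 m, BddBelow (ψ '' Icc 0 t) := by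
    rintro t ht
    refine ⟨0, ?_⟩
    rintro _ ⟨r, hr, rfl⟩
    exact htail r ⟨hr.1, hr.2.trans ht.2⟩
  have hne : ∀ t ∈ Icc 0 m, (ψ '' Icc 0 t).Nonempty := fun t ht =>
    (nonempty_Icc.2 ht.1).image _
  have hHψ : ∀ t ∈ Icc 0 m, H t ≤ ψ t := fun t ht =>
    csInf_le (hbdd t ht) ⟨t, ⟨ht.1, le_rfl⟩, rfl⟩
  have hanti : AntitoneOn H (Icc 0 m) := fun a ha b hb hab =>
    csInf_le_csInf (hbdd b hb) (hne a ha) (image_mono (Icc_subset_Icc_right hab))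
  have hLH : ∀ a ∈ Icc 0 m, ∀ b ∈ Icc 0 m, a ≤ b → H a - H b ≤ L b - L a := by
    intro a ha b hb hab
    have hLab : L b - L a = ∫ r in a..b, |u r| :=
      intervalIntegral.integral_interval_sub_left (hsub ⟨le_rfl, hm⟩ hb).abs
        (hsub ⟨le_rfl, hm⟩ ha).abs
    suffices H a - (L b - L a) ≤ H b by linarith
    refine le_csInf (hne b hb) ?_
    rintro _ ⟨r, hr, rfl⟩
    have hrm : r ∈ Icc 0 m := ⟨hr.1, hr.2.trans hb.2⟩
    rcases le_total r a with hra | har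
    · have h1 : H a ≤ ψ r := csInf_le (hbdd a ha) ⟨r, ⟨hr.1, hra⟩, rfl⟩
      have h2 : 0 ≤ L b - L a := by
        rw [hLab]
        exact intervalIntegral.integral_nonneg hab fun _ _ => abs_nonneg _
      linarith
    · have h1 : ψ a - ψ r = ∫ x in a..r, u x := by
        simp only [hψ]
        rw [← intervalIntegral.integral_add_adjacent_intervals (hsub ha hrm)
          (hsub hrm ⟨hm, le_rfl⟩)]
        ring
      have h2 : ∫ x in a..r, u x ≤ ∫ x in a..r, |u x| :=
        intervalIntegral.integral_mono_on har (hsub ha hrm) (hsub ha hrm).abs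
          fun x _ => le_abs_self _
      have h3 : ∫ x in a..r, |u x| ≤ ∫ x in a..b, |u x| := by
        rw [← intervalIntegral.integral_add_adjacent_intervals (hsub ha hrm).abs
          (hsub hrm hb).abs]
        have := intervalIntegral.integral_nonneg (f := fun x => |u x|) (μ := volume) hr.2
          fun _ _ => abs_nonneg _
        linarith
      have h4 := hHψ a ha
      linarith
  have hdist : ∀ a ∈ Icc 0 m, ∀ b ∈ Icc 0 m, dist (H a) (H b) ≤ dist (L a) (L b) := by
    have hle : ∀ a ∈ Icc 0 m, ∀ b ∈ Icc 0 m, a ≤ b → dist (H a) (H b) ≤ dist (L a) (L b) := by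
      intro a ha b hb hab
      rw [Real.dist_eq, abs_of_nonneg (sub_nonneg.2 (hanti ha hb hab)), dist_comm, Real.dist_eq]
      exact (hLH a ha b hb hab).trans (le_abs_self _)
    intro a ha b hb
    rcases le_total a b with h | h
    · exact hle a ha b hb h
    · rw [dist_comm (H a), dist_comm (L a)]
      exact hle b hb a ha h
  have hLac : AbsolutelyContinuousOnInterval L 0 m :=
    hu.abs.absolutelyContinuousOnInterval_intervalIntegral left_mem_uIcc
  have hHac : AbsolutelyContinuousOnInterval H 0 m := by
    rw [absolutelyContinuousOnInterval_iff] at hLac ⊢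
    intro ε hε
    obtain ⟨δ, hδ, h⟩ := hLac ε hε
    refine ⟨δ, hδ, fun E hE hlen => lt_of_le_of_lt ?_ (h E hE hlen)⟩
    refine Finset.sum_le_sum fun i hi => ?_
    have := hE.1 i hi
    rw [uIcc_of_le hm] at this
    exact hdist _ this.1 _ this.2
  have hHm : H m = 0 := by
    have h1 := hHψ m ⟨hm, le_rfl⟩
    simp only [hψ, intervalIntegral.integral_same] at h1
    refine le_antisymm h1 (le_csInf (hne m ⟨hm, le_rfl⟩) ?_)
    rintro _ ⟨r, hr, rfl⟩
    exact htail r hr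
  have hH0 : H 0 = ψ 0 := by simp [hH]
  have hint : ∀ t ∈ Icc 0 m, ∫ r in t..m, -deriv H r = H t := by
    intro t ht
    rw [intervalIntegral.integral_neg, (hHac.mono (c := t) (d := m) ?_).integral_deriv_eq_sub, hHm]
    · ring
    · rw [uIcc_of_le hm, uIcc_of_le ht.2]
      exact Icc_subset_Icc_left ht.1
  refine ⟨fun r => -deriv H r, hHac.intervalIntegrable_deriv.neg, fun t ht => ?_,
    fun t ht => (hint t ht).trans_le (hHψ t ht), (hint 0 ⟨le_rfl, hm⟩).trans hH0⟩
  have hnhds : Icc 0 m ∈ nhds t := Icc_mem_nhds ht.1 ht.2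
  have hd := hanti.derivWithin_nonpos (x := t)
  rw [derivWithin_of_mem_nhds hnhds] at hd
  exact neg_nonneg.2 hd

lemma LinGrowth.exists_nonneg {φ : ℝ → ℝ} (hφ : LinGrowth φ) :
    ∃ C, 0 ≤ C ∧ ∀ x, |φ x| ≤ C * (1 + |x|) := by
  obtain ⟨C, hC⟩ := hφ
  exact ⟨C, by simpa using (abs_nonneg _).trans (hC 0), hC⟩

lemma LinGrowth.const (c : ℝ) : LinGrowth fun _ => c :=
  ⟨|c|, fun x => le_mul_of_one_le_right (abs_nonneg c) (by linarith [abs_nonneg x])⟩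

lemma LinGrowth.id : LinGrowth fun x => x := ⟨1, fun x => by linarith⟩

lemma LinGrowth.add {φ ψ : ℝ → ℝ} (hφ : LinGrowth φ) (hψ : LinGrowth ψ) :
    LinGrowth fun x => φ x + ψ x := by
  obtain ⟨C, hC⟩ := hφ
  obtain ⟨D, hD⟩ := hψ
  exact ⟨C + D, fun x => by linarith [abs_add_le (φ x) (ψ x), hC x, hD x]⟩

lemma LinGrowth.comp {φ k : ℝ → ℝ} (hφ : LinGrowth φ) (hk : LinGrowth k) :
    LinGrowth fun x => φ (k x) := by
  obtain ⟨C, hC0, hC⟩ := hφ.exists_nonneg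
  obtain ⟨D, hD⟩ := hk
  refine ⟨C * (1 + D), fun x => (hC (k x)).trans ?_⟩
  rw [mul_assoc]
  refine mul_le_mul_of_nonneg_left ?_ hC0
  linarith [hD x, abs_nonneg x]

lemma LinGrowth.const_mul {φ : ℝ → ℝ} (c : ℝ) (hφ : LinGrowth φ) :
    LinGrowth fun x => c * φ x :=
  LinGrowth.comp (φ := fun y => c * y)
    ⟨|c|, fun x => by rw [abs_mul]; nlinarith [abs_nonneg c]⟩ hφ

lemma LinGrowth.max_const (a : ℝ) : LinGrowth fun x => max x a := by
  refine ⟨1 + |a|, fun x => ?_⟩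
  have := abs_max_le_max_abs_abs (a := x) (b := a)
  have h2 := max_le_add_of_nonneg (abs_nonneg x) (abs_nonneg a)
  nlinarith [abs_nonneg x, abs_nonneg a, mul_nonneg (abs_nonneg a) (abs_nonneg x)]

lemma convexOn_max_const (a : ℝ) : ConvexOn ℝ univ fun x : ℝ => max x a :=
  (convexOn_id convex_univ).sup (convexOn_const a convex_univ)

lemma leCS.real_univ_eq {μ ν : Measure ℝ} (h : leCS μ ν) : μ.real univ = ν.real univ := by
  have h1 := h _ (LinGrowth.const 1) (convexOn_const 1 convex_univ) monotone_const
  have h2 := h _ (LinGrowth.const (-1)) (convexOn_const (-1) convex_univ) monotone_const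
  simp only [integral_const, smul_eq_mul] at h1 h2
  linarith

lemma leCS.integral_id_le {μ ν : Measure ℝ} (h : leCS μ ν) : ∫ x, x ∂μ ≤ ∫ x, x ∂ν :=
  h _ LinGrowth.id (convexOn_id convex_univ) monotone_id

/-- With equal barycenters, the increasing convex order implies the convex order. -/
lemma leCS.leC_of_integral_id_eq {μ ν : Measure ℝ} (hμ : MemM μ) (hν : MemM ν) (h : leCS μ ν)
    (hmean : ∫ x, x ∂μ = ∫ x, x ∂ν) : leC μ ν := by
  intro φ hφ hc
  obtain ⟨s, -, ⟨C, hC⟩, hs⟩ := hc.exists_monotone_subgradient hφ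
  have hmono : Monotone fun x => φ x + C * x := by
    intro x y hxy
    have := hs x y
    have := (abs_le.1 (hC x)).1
    simp only
    nlinarith
  have hlin : ConvexOn ℝ univ fun x : ℝ => C * x :=
    (C • LinearMap.id (R := ℝ) (M := ℝ)).convexOn convex_univ
  have key := h _ (hφ.add (LinGrowth.id.const_mul C)) (hc.add hlin) hmono
  rw [integral_add (hφ.integrable hc.measurable_of_univ hμ) (hμ.2.const_mul C),
    integral_add (hφ.integrable hc.measurable_of_univ hν) (hν.2.const_mul C),
    integral_const_mul, integral_const_mul, hmean] at key
  linarith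

lemma MemM.map {μ : Measure ℝ} (hμ : MemM μ) {k : ℝ → ℝ} (hk : LinGrowth k)
    (hkm : Measurable k) : MemM (μ.map k) := by
  have := hμ.1
  exact ⟨inferInstance, (integrable_map_measure measurable_id.aestronglyMeasurable
    hkm.aemeasurable).2 (hk.integrable hkm hμ)⟩

/-- If `μ` is below `ν` in the increasing convex order and truncating `μ` from below at `a` gives
it the barycenter of `ν`, then the truncated measure is below `ν` in the convex order. -/
lemma leCS.leC_map_max {μ ν : Measure ℝ} (hμ : MemM μ) (hν : MemM ν) (h : leCS μ ν) {a : ℝ}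
    (ha : ∫ x, max x a ∂μ = ∫ x, x ∂ν) : leC (μ.map fun x => max x a) ν := by
  intro φ hφ hc
  have hmax : Measurable fun x : ℝ => max x a := by fun_prop
  have hφm := hc.measurable_of_univ
  obtain ⟨s, hsm, -, hs⟩ := hc.exists_monotone_subgradient hφ
  have hψ : ConvexOn ℝ univ fun x => φ x + -(s a) * x :=
    hc.add ((-(s a) • LinearMap.id (R := ℝ) (M := ℝ)).convexOn convex_univ)
  have hψm : MonotoneOn (fun x => φ x + -(s a) * x) (Ici a) := by
    intro x hx y _ hxy
    have h1 := hs x y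
    have h2 := mul_le_mul_of_nonneg_right (hsm hx) (sub_nonneg.2 hxy)
    simp only
    linarith
  have hrange : (fun x : ℝ => max x a) '' univ = Ici a := by
    ext y
    simp only [image_univ, mem_range, mem_Ici]
    exact ⟨fun ⟨x, hx⟩ => hx ▸ le_max_right x a, fun hy => ⟨y, max_eq_left hy⟩⟩
  have hg : ConvexOn ℝ univ fun x => φ (max x a) + -(s a) * max x a :=
    ConvexOn.comp (g := fun x => φ x + -(s a) * x) (f := fun x => max x a)
      (by rw [hrange]; exact hψ.subset (subset_univ _) (convex_Ici a))
      (convexOn_max_const a) (by rwa [hrange])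
  have hgm : Monotone fun x => φ (max x a) + -(s a) * max x a := fun x y hxy =>
    hψm (le_max_right x a) (le_max_right y a) (max_le_max_right a hxy)
  have hcomp := hφ.comp (LinGrowth.max_const a)
  have hglin := hcomp.add ((LinGrowth.max_const a).const_mul (-(s a)))
  have key := h _ hglin hg hgm
  rw [integral_map hmax.aemeasurable hφm.aestronglyMeasurable]
  have hle : ∫ x, (φ (max x a) + -(s a) * max x a) ∂ν ≤ ∫ x, (φ x + -(s a) * x) ∂ν := by
    refine integral_mono (hglin.integrable hg.measurable_of_univ hν)
      ((hφ.add (LinGrowth.id.const_mul _)).integrable hψ.measurable_of_univ hν) fun x => ?_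
    rcases le_total a x with hx | hx
    · simp [max_eq_left hx]
    · simp only [max_eq_right hx]
      linarith [hs a x]
  rw [integral_add (hφ.integrable hφm hν) (hν.2.const_mul _), integral_const_mul] at hle
  rw [integral_add (hcomp.integrable (hφm.comp hmax) hμ)
    (((LinGrowth.max_const a).integrable hmax hμ).const_mul _), integral_const_mul, ha] at key
  linarith

lemma leSto_map_max {μ : Measure ℝ} (hμ : MemM μ) (a : ℝ) : leSto μ (μ.map fun x => max x a) := by
  intro φ hφ hm
  have hmax : Measurable fun x : ℝ => max x a := by fun_prop
  rw [integral_map hmax.aemeasurable hm.measurable.aestronglyMeasurable]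
  exact integral_mono (hφ.integrable hm.measurable hμ)
    ((hφ.comp (LinGrowth.max_const a)).integrable (hm.measurable.comp hmax) hμ)
    fun x => hm (le_max_left x a)

lemma exists_integral_max_eq {μ : Measure ℝ} (hμ : MemM μ) (hpos : 0 < μ.real univ) {d : ℝ}
    (hd : ∫ x, x ∂μ < d) : ∃ a : ℝ, ∫ x, max x a ∂μ = d := by
  have := hμ.1
  have hmax : ∀ a : ℝ, Measurable fun x : ℝ => max x a := fun a => by fun_prop
  have hint : ∀ a : ℝ, Integrable (fun x => max x a) μ := fun a =>
    (LinGrowth.max_const a).integrable (hmax a) hμ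
  have hcont : Continuous fun a : ℝ => ∫ x, max x a ∂μ := by
    refine (LipschitzWith.of_dist_le_mul (K := (μ.real univ).toNNReal) fun a b => ?_).continuous
    rw [Real.dist_eq, Real.dist_eq, ← integral_sub (hint a) (hint b),
      Real.coe_toNNReal _ hpos.le, mul_comm]
    have hb : ∀ᵐ x ∂μ, ‖max x a - max x b‖ ≤ |a - b| := Eventually.of_forall fun x => by
      rw [Real.norm_eq_abs, max_comm x, max_comm x]
      exact abs_max_sub_max_le_abs a b x
    exact norm_integral_le_of_norm_le_const hb
  have hbot : Tendsto (fun a : ℝ => ∫ x, max x a ∂μ) atBot (nhds (∫ x, x ∂μ)) := by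
    refine tendsto_integral_filter_of_dominated_convergence (fun x => |x|)
      (Eventually.of_forall fun a => (hmax a).aestronglyMeasurable) ?_ hμ.2.abs
      (Eventually.of_forall fun x => ?_)
    · filter_upwards [eventually_le_atBot (0 : ℝ)] with a ha
      refine Eventually.of_forall fun x => ?_
      rw [Real.norm_eq_abs, abs_le]
      exact ⟨(neg_abs_le x).trans (le_max_left x a), max_le (le_abs_self x) (ha.trans (abs_nonneg x))⟩
    · refine tendsto_const_nhds.congr' ?_
      filter_upwards [eventually_le_atBot x] with a ha
      rw [max_eq_left ha]
  refine mem_range_of_exists_le_of_exists_ge hcont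
    ((hbot.eventually (gt_mem_nhds hd)).exists.imp fun a ha => ha.le) ⟨d / μ.real univ, ?_⟩
  have h1 : ∫ _, d / μ.real univ ∂μ ≤ ∫ x, max x (d / μ.real univ) ∂μ :=
    integral_mono (integrable_const _) (hint _) fun x => le_max_right _ _
  rwa [integral_const, smul_eq_mul, mul_div_cancel₀ _ hpos.ne'] at h1

lemma leCS.exists_leSto_leC {μ ν : Measure ℝ} (hμ : MemM μ) (hν : MemM ν) (h : leCS μ ν) :
    ∃ η : Measure ℝ, MemM η ∧ leSto μ η ∧ leC η ν := by
  rcases h.integral_id_le.eq_or_lt with heq | hlt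
  · exact ⟨μ, hμ, fun φ _ _ => le_rfl, h.leC_of_integral_id_eq hμ hν heq⟩
  · have := hμ.1
    have := hν.1
    have hpos : 0 < μ.real univ := by
      refine lt_of_le_of_ne measureReal_nonneg fun h0 => hlt.ne ?_
      have h1 : μ = 0 := by
        rwa [eq_comm, measureReal_eq_zero_iff, Measure.measure_univ_eq_zero] at h0
      have h2 : ν = 0 := by
        rwa [h.real_univ_eq, eq_comm, measureReal_eq_zero_iff,
          Measure.measure_univ_eq_zero] at h0
      simp [h1, h2]
    obtain ⟨a, ha⟩ := exists_integral_max_eq hμ hpos hlt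
    exact ⟨μ.map fun x => max x a, hμ.map (LinGrowth.max_const a) (by fun_prop),
      leSto_map_max hμ a, h.leC_map_max hμ hν ha⟩

/-- The increasing convex order compares the tail integrals of quantile representations. -/
lemma leCS.setIntegral_Ioo_le {μ ν : Measure ℝ} {m : ℝ} {X Y : ℝ → ℝ} (h : leCS μ ν)
    (hX : AEMeasurable X (volume.restrict (Ioo 0 m)))
    (hXμ : Measure.map X (volume.restrict (Ioo 0 m)) = μ)
    (hXi : IntegrableOn X (Ioo 0 m)) (hY : MonotoneOn Y (Ioo 0 m))
    (hYν : Measure.map Y (volume.restrict (Ioo 0 m)) = ν)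
    (hYi : IntegrableOn Y (Ioo 0 m)) {t : ℝ} (ht : t ∈ Ioo 0 m) :
    ∫ r in Ioo t m, X r ≤ ∫ r in Ioo t m, Y r := by
  set k := Y t with hk
  have hsub : Ioo t m ⊆ Ioo 0 m := Ioo_subset_Ioo_left ht.1.le
  have hφ : LinGrowth fun x => max (x + -k) 0 :=
    (LinGrowth.max_const 0).comp (LinGrowth.id.add (LinGrowth.const (-k)))
  have hconv : ConvexOn ℝ univ fun x => max (x + -k) 0 :=
    ((convexOn_id convex_univ).add (convexOn_const (-k) convex_univ)).sup
      (convexOn_const 0 convex_univ)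
  have hmono : Monotone fun x => max (x + -k) 0 := fun x y hxy =>
    max_le_max_right 0 (by simpa using hxy)
  have hφm : Measurable fun x => max (x + -k) 0 := hmono.measurable
  have key := h _ hφ hconv hmono
  have hYm : AEMeasurable Y (volume.restrict (Ioo 0 m)) :=
    aemeasurable_restrict_of_monotoneOn measurableSet_Ioo hY
  rw [← hXμ, ← hYν, integral_map hX hφm.aestronglyMeasurable,
    integral_map hYm hφm.aestronglyMeasurable] at key
  have hconst : IntegrableOn (fun _ : ℝ => -k) (Ioo 0 m) := integrable_const _
  have hXk : IntegrableOn (fun r => max (X r + -k) 0) (Ioo 0 m) :=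
    (hXi.add hconst).pos_part
  have h1 : ∫ r in Ioo t m, (X r + -k) ≤ ∫ r in Ioo 0 m, max (X r + -k) 0 :=
    calc _ ≤ ∫ r in Ioo t m, max (X r + -k) 0 :=
          integral_mono ((hXi.add hconst).mono_set hsub) (hXk.mono_set hsub)
            fun r => le_max_left _ _
      _ ≤ _ := setIntegral_mono_set hXk (Eventually.of_forall fun r => le_max_right _ _)
          hsub.eventuallyLE
  have h2 : ∫ r in Ioo 0 m, max (Y r + -k) 0 = ∫ r in Ioo t m, (Y r + -k) := by
    rw [setIntegral_eq_of_subset_of_forall_sdiff_eq_zero measurableSet_Ioo hsub]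
    · refine setIntegral_congr_fun measurableSet_Ioo fun r hr => max_eq_left ?_
      have := hY ht (hsub hr) hr.1.le
      linarith
    · intro r hr
      have hrt : r ≤ t := by
        by_contra! hlt
        exact hr.2 ⟨hlt, hr.1.2⟩
      have := hY hr.1 ht hrt
      exact max_eq_right (by linarith)
  have h3 := h1.trans (key.trans_eq h2)
  rw [integral_add (hXi.mono_set hsub) (hconst.mono_set hsub),
    integral_add (hYi.mono_set hsub) (hconst.mono_set hsub)] at h3
  linarith

lemma leCS.exists_leC_leSto {μ ν : Measure ℝ} (hμ : MemM μ) (hν : MemM ν) (h : leCS μ ν) :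
    ∃ η : Measure ℝ, MemM η ∧ leC μ η ∧ leSto η ν := by
  have := hμ.1
  have := hν.1
  obtain ⟨X, hX, hXμ⟩ := exists_monotoneOn_map_volume_eq μ
  obtain ⟨Y, hY, hYν⟩ := exists_monotoneOn_map_volume_eq ν
  rw [← h.real_univ_eq] at hY hYν
  set m := μ.real univ with hm
  have hm0 : 0 ≤ m := measureReal_nonneg
  have hXm : AEMeasurable X (volume.restrict (Ioo 0 m)) :=
    aemeasurable_restrict_of_monotoneOn measurableSet_Ioo hX
  have hYm : AEMeasurable Y (volume.restrict (Ioo 0 m)) :=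
    aemeasurable_restrict_of_monotoneOn measurableSet_Ioo hY
  have hcomp : ∀ {κ : Measure ℝ} {Z φ : ℝ → ℝ}, AEMeasurable Z (volume.restrict (Ioo 0 m)) →
      Measure.map Z (volume.restrict (Ioo 0 m)) = κ → Measurable φ → Integrable φ κ →
      IntegrableOn (fun t => φ (Z t)) (Ioo 0 m) := by
    rintro κ Z φ hZ rfl hφ hi
    exact (integrable_map_measure hφ.aestronglyMeasurable hZ).1 hi
  have hXi : IntegrableOn X (Ioo 0 m) := hcomp (φ := id) hXm hXμ measurable_id hμ.2
  have hYi : IntegrableOn Y (Ioo 0 m) := hcomp (φ := id) hYm hYν measurable_id hν.2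
  have hu : IntervalIntegrable (fun t => Y t - X t) volume 0 m :=
    (intervalIntegrable_iff_integrableOn_Ioo_of_le hm0).2 (hYi.sub hXi)
  have hmean : ∫ r in Ioo 0 m, X r ≤ ∫ r in Ioo 0 m, Y r := by
    have := h.integral_id_le
    rwa [← hXμ, ← hYν, integral_map (f := fun x => x) hXm measurable_id.aestronglyMeasurable,
      integral_map (f := fun x => x) hYm measurable_id.aestronglyMeasurable] at this
  have htail : ∀ t ∈ Icc 0 m, 0 ≤ ∫ r in t..m, (Y r - X r) := by
    intro t ht
    rw [intervalIntegral.integral_of_le ht.2, integral_Ioc_eq_integral_Ioo,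
      integral_sub (hYi.mono_set (Ioo_subset_Ioo_left ht.1))
        (hXi.mono_set (Ioo_subset_Ioo_left ht.1)), sub_nonneg]
    rcases ht.1.eq_or_lt with rfl | h0
    · exact hmean
    rcases ht.2.eq_or_lt with rfl | h1
    · simp
    · exact h.setIntegral_Ioo_le hXm hXμ hXi hY hYν hYi ⟨h0, h1⟩
  obtain ⟨g, hg, hg0, hgtail, hgtot⟩ := exists_nonneg_tail_le hm0 hu htail
  have hgi : IntegrableOn g (Ioo 0 m) := (intervalIntegrable_iff_integrableOn_Ioo_of_le hm0).1 hg
  set Z : ℝ → ℝ := fun t => Y t - g t with hZ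
  have hZi : IntegrableOn Z (Ioo 0 m) := hYi.sub hgi
  have hZm : AEMeasurable Z (volume.restrict (Ioo 0 m)) := hZi.aemeasurable
  have hη : MemM (Measure.map Z (volume.restrict (Ioo 0 m))) :=
    ⟨inferInstance, (integrable_map_measure measurable_id.aestronglyMeasurable hZm).2 hZi⟩
  refine ⟨_, hη, fun φ hφ hc => ?_, fun φ hφ hmono => ?_⟩
  · have hφm := hc.measurable_of_univ
    obtain ⟨s, hsm, ⟨C, hC⟩, hs⟩ := hc.exists_monotone_subgradient hφ
    have hw : IntegrableOn (fun t => Z t - X t) (Ioo 0 m) := hZi.sub hXi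
    have hdiff : ∀ t ∈ Icc 0 m, ∫ r in Ioo t m, (Z r - X r)
        = (∫ r in t..m, (Y r - X r)) - ∫ r in t..m, g r := by
      intro t ht
      have hsub : Ioo t m ⊆ Ioo 0 m := Ioo_subset_Ioo_left ht.1
      rw [intervalIntegral.integral_of_le ht.2, intervalIntegral.integral_of_le ht.2,
        integral_Ioc_eq_integral_Ioo, integral_Ioc_eq_integral_Ioo,
        ← integral_sub (f := fun r => Y r - X r) ((hYi.sub hXi).mono_set hsub)
          (hgi.mono_set hsub)]
      exact integral_congr_ae (Eventually.of_forall fun r => by simp only [hZ]; ring)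
    have hnn : 0 ≤ ∫ t in Ioo 0 m, s (X t) * (Z t - X t) :=
      integral_mul_nonneg_of_tail_nonneg (s := fun t => s (X t)) hw
        (fun t ht => by rw [hdiff t ht]; exact sub_nonneg.2 (hgtail t ht))
        (by rw [hdiff 0 ⟨le_rfl, hm0⟩, hgtot, sub_self])
        (fun a ha b hb hab => hsm (hX ha hb hab)) (fun t => hC (X t))
    have hsw : IntegrableOn (fun t => s (X t) * (Z t - X t)) (Ioo 0 m) :=
      Integrable.bdd_mul hw (hsm.measurable.comp_aemeasurable hXm).aestronglyMeasurable
        (c := C) (Eventually.of_forall fun t => hC (X t))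
    have hφX : IntegrableOn (fun t => φ (X t)) (Ioo 0 m) :=
      hcomp hXm hXμ hφm (hφ.integrable hφm hμ)
    have hφZ : IntegrableOn (fun t => φ (Z t)) (Ioo 0 m) :=
      hcomp hZm rfl hφm (hφ.integrable hφm hη)
    have hle := integral_mono (hφX.add hsw) hφZ fun t => hs (X t) (Z t)
    rw [integral_add' hφX hsw] at hle
    rw [integral_map hZm hφm.aestronglyMeasurable, ← hXμ,
      integral_map hXm hφm.aestronglyMeasurable]
    linarith
  · have hφm := hmono.measurable
    rw [integral_map hZm hφm.aestronglyMeasurable, ← hYν,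
      integral_map hYm hφm.aestronglyMeasurable]
    refine setIntegral_mono_on (hcomp hZm rfl hφm (hφ.integrable hφm hη))
      (hcomp hYm hYν hφm (hφ.integrable hφm hν)) measurableSet_Ioo fun t ht => hmono ?_
    exact sub_le_self _ (hg0 t ht)

/-- decomposition of the order `≤_{C,sto}`. -/
theorem leCS_iff_decomposition (μ ν : Measure ℝ) (hμ : MemM μ) (hν : MemM ν) :
    (leCS μ ν ↔ ∃ η : Measure ℝ, MemM η ∧ leSto μ η ∧ leC η ν) ∧
    (leCS μ ν ↔ ∃ η' : Measure ℝ, MemM η' ∧ leC μ η' ∧ leSto η' ν) := by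
  refine ⟨⟨fun h => h.exists_leSto_leC hμ hν, ?_⟩, ⟨fun h => h.exists_leC_leSto hμ hν, ?_⟩⟩
  · rintro ⟨η, -, h₁, h₂⟩ φ hφ hc hm
    exact (h₁ φ hφ hm).trans (h₂ φ hφ hc)
  · rintro ⟨η, -, h₁, h₂⟩ φ hφ hc hm
    exact (h₁ φ hφ hc).trans (h₂ φ hφ hm)

end
end

section
/- Let μ, ν ∈ M satisfy μ ≤_{C,+} ν and suppose y = sup(spt μ) is finite. Let η = S^ν(μ) be the shadow of μ in ν, and let θ₀ be the restriction to [y,∞) of the positive part (η − μ)₊ of the signed measure η − μ. Then θ₀ is the stochastically smallest measure of its mass dominated by the restriction to [y,∞) of (ν − μ)₊: for every θ ∈ M with θ(ℝ) = θ₀(ℝ) and θ ≤_+ ((ν − μ)₊)|_{[y,∞)}, one has θ₀ ≤_sto θ. -/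
open MeasureTheory Set Filter ProbabilityTheory

noncomputable section

/-- A convex function lies above each of its right tangent lines. -/
lemma rightTangent_le {φ : ℝ → ℝ} (hc : ConvexOn ℝ univ φ) (x w : ℝ) :
    φ x + derivWithin φ (Ioi x) x * (w - x) ≤ φ w := by
  have hx : x ∈ interior (univ : Set ℝ) := by simp
  rcases lt_trichotomy x w with h | rfl | h
  · have h1 := hc.rightDeriv_le_slope_of_mem_interior hx (mem_univ w) h
    rw [slope_def_field, le_div_iff₀ (by linarith)] at h1
    linarith
  · simp
  · have h1 := hc.slope_le_leftDeriv_of_mem_interior (mem_univ w) hx h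
    have h2 := h1.trans (hc.leftDeriv_le_rightDeriv_of_mem_interior hx)
    rw [slope_def_field, div_le_iff₀ (by linarith)] at h2
    linarith

lemma abs_rightDeriv_le {φ : ℝ → ℝ} (hc : ConvexOn ℝ univ φ) {C : ℝ}
    (hC : ∀ x, |φ x| ≤ C * (1 + |x|)) (x : ℝ) : |derivWithin φ (Ioi x) x| ≤ C := by
  have key := rightTangent_le hc x
  set d := derivWithin φ (Ioi x) x
  by_contra! h
  set B := |C + d * x - φ x| with hB
  have hpos : 0 < |d| - C := by linarith
  set w := (B + 1) / (|d| - C) with hw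
  have hwpos : 0 ≤ w := by positivity
  have hwe : (|d| - C) * w = B + 1 := by rw [hw]; field_simp
  have hBl := le_abs_self (C + d * x - φ x)
  rcases le_total 0 d with hd | hd
  · have h1 := key w
    have h2 := (le_abs_self _).trans (hC w)
    rw [abs_of_nonneg hwpos] at h2
    rw [abs_of_nonneg hd] at hwe
    nlinarith
  · have h1 := key (-w)
    have h2 := (le_abs_self _).trans (hC (-w))
    rw [abs_neg, abs_of_nonneg hwpos] at h2
    rw [abs_of_nonpos hd] at hwe
    nlinarith

lemma monotone_rightDeriv {φ : ℝ → ℝ} (hc : ConvexOn ℝ univ φ) :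
    Monotone fun x => derivWithin φ (Ioi x) x := by
  have := hc.monotoneOn_rightDeriv
  rwa [interior_univ, monotoneOn_univ] at this

lemma continuous_of_convexOn_univ {φ : ℝ → ℝ} (hc : ConvexOn ℝ univ φ) : Continuous φ :=
  continuousOn_univ.1 (hc.continuousOn isOpen_univ)

lemma integral_rightDeriv {φ : ℝ → ℝ} (hc : ConvexOn ℝ univ φ) (x : ℝ) :
    ∫ s in (0 : ℝ)..x, derivWithin φ (Ioi s) s = φ x - φ 0 :=
  intervalIntegral.integral_eq_sub_of_hasDeriv_right
    (continuous_of_convexOn_univ hc).continuousOn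
    (fun _ _ => hc.hasDerivWithinAt_rightDeriv_of_mem_interior (by simp))
    (monotone_rightDeriv hc).intervalIntegrable

lemma convexOn_hinge (t : ℝ) : ConvexOn ℝ univ fun x : ℝ => max (x - t) 0 :=
  ((convexOn_id convex_univ).sub (concaveOn_const t convex_univ)).sup
    (convexOn_const 0 convex_univ)

lemma integral_hinge_deriv {τ : ℝ} {U : Set ℝ} (h1 : ∀ s, τ < s → s ∈ U)
    (h2 : ∀ s, s < τ → s ∉ U)
    (hU : ∀ a b : ℝ, IntervalIntegrable (U.indicator fun _ => (1 : ℝ)) volume a b) (x : ℝ) :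
    ∫ s in (0 : ℝ)..x, U.indicator (fun _ => (1 : ℝ)) s = max (x - τ) 0 - max (0 - τ) 0 := by
  refine MeasureTheory.integral_eq_of_hasDerivAt_off_countable (fun x => max (x - τ) 0) _
    (countable_singleton τ) (by fun_prop) (fun s hs => ?_) (hU _ _)
  rcases lt_or_gt_of_ne hs.2 with h | h
  · rw [indicator_of_notMem (h2 s h)]
    refine (hasDerivAt_const s (0 : ℝ)).congr_of_eventuallyEq ?_
    filter_upwards [Iio_mem_nhds h] with u hu
    exact max_eq_right (by simp at hu; linarith)
  · rw [indicator_of_mem (h1 s h)]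
    refine ((hasDerivAt_id s).sub_const τ).congr_of_eventuallyEq ?_
    filter_upwards [Ioi_mem_nhds h] with u hu
    exact max_eq_left (by simp at hu; linarith)

/-- The primitive of a super-level indicator of a monotone function is affine or a hinge. -/
lemma exists_hinge_of_superlevel {g : ℝ → ℝ} (hg : Monotone g) (l : ℝ) :
    ∃ a b c τ : ℝ, 0 ≤ c ∧ ∀ x, ∫ s in (0 : ℝ)..x, {s | l < g s}.indicator (fun _ => (1 : ℝ)) s
      = a + b * x + c * max (x - τ) 0 := by
  set U := {s | l < g s}
  have hup : ∀ s ∈ U, ∀ t, s ≤ t → t ∈ U := fun s hs t hst => lt_of_lt_of_le hs (hg hst)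
  by_cases hne : U.Nonempty
  · by_cases hb : BddBelow U
    · refine ⟨- max (0 - sInf U) 0, 0, 1, sInf U, zero_le_one, fun x => ?_⟩
      rw [integral_hinge_deriv (τ := sInf U)]
      · ring
      · intro s hs
        obtain ⟨u, hu, hus⟩ := exists_lt_of_csInf_lt hne hs
        exact hup u hu s hus.le
      · exact fun s hs hsU => (csInf_le hb hsU).not_gt hs
      · intro a b
        refine Monotone.intervalIntegrable fun s t hst => ?_
        by_cases hs : s ∈ U
        · rw [indicator_of_mem hs, indicator_of_mem (hup s hs t hst)]
        · rw [indicator_of_notMem hs]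
          exact indicator_nonneg (fun _ _ => zero_le_one) t
    · refine ⟨0, 1, 0, 0, le_rfl, fun x => ?_⟩
      have : U = univ := by
        refine eq_univ_of_forall fun s => ?_
        obtain ⟨u, hu, hus⟩ := not_bddBelow_iff.1 hb s
        exact hup u hu s hus.le
      simp [this]
  · refine ⟨0, 0, 0, 0, le_rfl, fun x => ?_⟩
    simp [not_nonempty_iff_eq_empty.1 hne]

lemma abs_sum_indicator_sub_le {N : ℕ} {v : ℝ} (h0 : 0 ≤ v) (hN : v ≤ N) :
    |v - ∑ j ∈ Finset.range N, if (j : ℝ) < v then (1 : ℝ) else 0| ≤ 1 := by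
  have : (Finset.range N).filter (fun j : ℕ => (j : ℝ) < v) = Finset.range ⌈v⌉₊ := by
    ext j
    simp only [Finset.mem_filter, Finset.mem_range, Nat.lt_ceil, and_iff_right_iff_imp]
    exact fun h => by exact_mod_cast h.trans_le hN
  rw [Finset.sum_boole, this, Finset.card_range, abs_le]
  have h1 := Nat.le_ceil v
  have h2 := Nat.ceil_lt_add_one h0
  constructor <;> linarith

/-- Convex functions of linear growth are approximated by combinations of hinges. -/
lemma exists_hinge_approx {φ : ℝ → ℝ} (hl : LinGrowth φ) (hc : ConvexOn ℝ univ φ) {ε : ℝ}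
    (hε : 0 < ε) : ∃ (N : ℕ) (A B : ℝ) (c τ : ℕ → ℝ), (∀ j, 0 ≤ c j) ∧
      ∀ x, |φ x - (A + B * x + ∑ j ∈ Finset.range N, c j * max (x - τ j) 0)| ≤ ε * |x| := by
  obtain ⟨C, hC⟩ := hl
  set g : ℝ → ℝ := fun x => derivWithin φ (Ioi x) x with hg
  have hgm : Monotone g := monotone_rightDeriv hc
  have hgb : ∀ x, |g x| ≤ C := abs_rightDeriv_le hc hC
  obtain ⟨N, hN⟩ := exists_nat_ge (2 * C / ε)
  choose a b c τ hc0 hH using fun j : ℕ => exists_hinge_of_superlevel hgm (-C + ε * j)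
  refine ⟨N, φ 0 + ε * ∑ j ∈ Finset.range N, a j, -C + ε * ∑ j ∈ Finset.range N, b j,
    fun j => ε * c j, τ, fun j => mul_nonneg hε.le (hc0 j), fun x => ?_⟩
  set I : ℕ → ℝ → ℝ := fun j => {s | -C + ε * j < g s}.indicator (fun _ => (1 : ℝ))
  have hI : ∀ j, IntervalIntegrable (I j) volume 0 x := by
    intro j
    refine Monotone.intervalIntegrable fun s t hst => ?_
    by_cases hs : -C + ε * j < g s
    · simp only [I]
      rw [indicator_of_mem (show s ∈ {s | -C + ε * j < g s} from hs),
        indicator_of_mem (show t ∈ {s | -C + ε * j < g s} from hs.trans_le (hgm hst))]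
    · simp only [I]
      rw [indicator_of_notMem (show s ∉ {s | -C + ε * j < g s} from hs)]
      exact indicator_nonneg (fun _ _ => zero_le_one) t
  have hsum : IntervalIntegrable (fun s => ε * ∑ j ∈ Finset.range N, I j s) volume 0 x := by
    have := (IntervalIntegrable.sum (Finset.range N) fun j _ => hI j).const_mul ε
    simpa using this
  have e1 : φ x - (φ 0 + ε * ∑ j ∈ Finset.range N, a j +
      (-C + ε * ∑ j ∈ Finset.range N, b j) * x +
      ∑ j ∈ Finset.range N, ε * c j * max (x - τ j) 0)
      = ∫ s in (0 : ℝ)..x, (g s - (-C + ε * ∑ j ∈ Finset.range N, I j s)) := by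
    rw [intervalIntegral.integral_sub hgm.intervalIntegrable, integral_rightDeriv hc,
      intervalIntegral.integral_add, intervalIntegral.integral_const_mul,
      intervalIntegral.integral_finsetSum (fun j _ => hI j), Finset.sum_congr rfl fun j _ => hH j x]
    · simp only [Finset.sum_add_distrib, ← Finset.sum_mul, mul_assoc, ← Finset.mul_sum,
        intervalIntegral.integral_const, smul_eq_mul]
      ring
    · simp
    · exact hsum
    · exact intervalIntegrable_const.add hsum
  rw [e1]
  have := intervalIntegral.norm_integral_le_of_norm_le_const (a := 0) (b := x) (C := ε)
    (f := fun s => g s - (-C + ε * ∑ j ∈ Finset.range N, I j s)) ?_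
  · simpa using this
  intro s _
  have hs := abs_le.1 (hgb s)
  have key := abs_sum_indicator_sub_le (N := N) (v := (g s + C) / ε)
    (div_nonneg (by linarith) hε.le)
    ((div_le_div_of_nonneg_right (by linarith) hε.le).trans hN)
  have e2 : ∀ j ∈ Finset.range N, I j s = if (j : ℝ) < (g s + C) / ε then (1 : ℝ) else 0 := by
    intro j _
    simp only [I, indicator_apply, mem_ofPred_eq]
    refine if_congr ?_ rfl rfl
    rw [lt_div_iff₀ hε]
    constructor <;> intro h <;> linarith
  rw [Finset.sum_congr rfl e2]
  set S := ∑ j ∈ Finset.range N, if (j : ℝ) < (g s + C) / ε then (1 : ℝ) else 0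
  have e3 : g s - (-C + ε * S) = ε * ((g s + C) / ε - S) := by field_simp; ring
  rw [e3, norm_mul, Real.norm_eq_abs, Real.norm_eq_abs, abs_of_pos hε]
  nlinarith

lemma integrable_of_linGrowth {m : Measure ℝ} [IsFiniteMeasure m]
    (hm : Integrable (fun x => x) m) {φ : ℝ → ℝ} (hl : LinGrowth φ) (hφ : Measurable φ) :
    Integrable φ m := by
  obtain ⟨C, hC⟩ := hl
  refine (((integrable_const (1 : ℝ)).add hm.abs).const_mul C).mono'
    hφ.aestronglyMeasurable (ae_of_all _ hC)

lemma linGrowth_hinge (t : ℝ) : LinGrowth fun x => max (x - t) 0 := by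
  refine ⟨1 + |t|, fun x => ?_⟩
  rw [abs_of_nonneg (le_max_right _ _)]
  refine max_le ?_ (by positivity)
  nlinarith [abs_nonneg x, abs_nonneg t, le_abs_self x, neg_abs_le t]

lemma integrable_hinge {m : Measure ℝ} [IsFiniteMeasure m]
    (hm : Integrable (fun x => x) m) (t : ℝ) : Integrable (fun x => max (x - t) 0) m :=
  integrable_of_linGrowth hm (linGrowth_hinge t) (by fun_prop)

/-- Comparison of the call potentials implies the convex order. -/
lemma leC_of_hinge_le {μ η : Measure ℝ} [IsFiniteMeasure μ] [IsFiniteMeasure η]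
    (hμ : Integrable (fun x => x) μ) (hη : Integrable (fun x => x) η)
    (hmass : μ.real univ = η.real univ) (hmean : ∫ x, x ∂μ = ∫ x, x ∂η)
    (hpot : ∀ t, ∫ x, max (x - t) 0 ∂μ ≤ ∫ x, max (x - t) 0 ∂η) : leC μ η := by
  intro φ hl hc
  have hm := (continuous_of_convexOn_univ hc).measurable
  refine le_of_forall_pos_le_add fun δ hδ => ?_
  set K := ∫ x, |x| ∂μ + ∫ x, |x| ∂η
  have hK : 0 ≤ K := add_nonneg (integral_nonneg fun _ => abs_nonneg _)
    (integral_nonneg fun _ => abs_nonneg _)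
  obtain ⟨N, A, B, c, τ, hc0, happ⟩ := exists_hinge_approx hl hc
    (ε := δ / (K + 1)) (by positivity)
  set ψ : ℝ → ℝ := fun x => A + B * x + ∑ j ∈ Finset.range N, c j * max (x - τ j) 0 with hψ
  have hint : ∀ (m : Measure ℝ) [IsFiniteMeasure m], Integrable (fun x => x) m →
      Integrable ψ m ∧ ∫ x, ψ x ∂m = A * m.real univ + B * ∫ x, x ∂m +
        ∑ j ∈ Finset.range N, c j * ∫ x, max (x - τ j) 0 ∂m := by
    intro m _ hm
    have h1 : Integrable (fun x => A + B * x) m := (integrable_const A).add (hm.const_mul B)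
    have h2 : Integrable (fun x => ∑ j ∈ Finset.range N, c j * max (x - τ j) 0) m :=
      integrable_finsetSum _ fun j _ => (integrable_hinge hm _).const_mul _
    refine ⟨h1.add h2, ?_⟩
    rw [hψ, integral_add h1 h2, integral_add (integrable_const A) (hm.const_mul B),
      integral_finsetSum _ fun j _ => (integrable_hinge hm _).const_mul _]
    rw [integral_const_mul]
    simp only [integral_const_mul, integral_const, smul_eq_mul, mul_comm]
  have herr : ∀ (m : Measure ℝ) [IsFiniteMeasure m], Integrable (fun x => x) m →
      |∫ x, φ x ∂m - ∫ x, ψ x ∂m| ≤ δ / (K + 1) * ∫ x, |x| ∂m := by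
    intro m _ hm'
    rw [← integral_sub (integrable_of_linGrowth hm' hl hm) (hint m hm').1, ← integral_const_mul]
    exact (abs_integral_le_integral_abs).trans (integral_mono_of_nonneg
      (ae_of_all _ fun _ => abs_nonneg _) (hm'.abs.const_mul _) (ae_of_all _ happ))
  have hψle : ∫ x, ψ x ∂μ ≤ ∫ x, ψ x ∂η := by
    rw [(hint μ hμ).2, (hint η hη).2, hmass, hmean]
    exact add_le_add_right
      (Finset.sum_le_sum fun j _ => mul_le_mul_of_nonneg_left (hpot _) (hc0 j)) _
  have h1 := (abs_le.1 (herr μ hμ)).2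
  have h2 := (abs_le.1 (herr η hη)).1
  have h3 : δ / (K + 1) * K ≤ δ := by
    rw [div_mul_eq_mul_div, div_le_iff₀ (by positivity)]; nlinarith
  simp only [K, mul_add] at h3
  linarith

lemma max_sub_zero_eq (t x : ℝ) : max (t - x) 0 = max (x - t) 0 + (t - x) := by
  rcases le_total x t with h | h
  · rw [max_eq_left (by linarith), max_eq_right (by linarith)]; ring
  · rw [max_eq_right (by linarith), max_eq_left (by linarith)]; ring

lemma integrable_put {m : Measure ℝ} [IsFiniteMeasure m]
    (hm : Integrable (fun x => x) m) (t : ℝ) : Integrable (fun x => max (t - x) 0) m := by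
  simp only [max_sub_zero_eq t]
  exact (integrable_hinge hm t).add ((integrable_const t).sub hm)

/-- Put-call parity. -/
lemma integral_put {m : Measure ℝ} [IsFiniteMeasure m]
    (hm : Integrable (fun x => x) m) (t : ℝ) :
    ∫ x, max (t - x) 0 ∂m = ∫ x, max (x - t) 0 ∂m + (t * m.real univ - ∫ x, x ∂m) := by
  have h : Integrable (fun x => t - x) m := (integrable_const t).sub hm
  simp only [max_sub_zero_eq t]
  rw [integral_add (integrable_hinge hm t) h,
    integral_sub (integrable_const t) hm, integral_const, smul_eq_mul, mul_comm t]

lemma convexOn_put {m : Measure ℝ} [IsFiniteMeasure m] (hm : Integrable (fun x => x) m) :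
    ConvexOn ℝ univ fun t => ∫ x, max (t - x) 0 ∂m := by
  refine ⟨convex_univ, fun s _ t _ a b ha hb hab => ?_⟩
  simp only [smul_eq_mul]
  rw [← integral_const_mul, ← integral_const_mul,
    ← integral_add ((integrable_put hm s).const_mul a) ((integrable_put hm t).const_mul b)]
  refine integral_mono (integrable_put hm _)
    (((integrable_put hm s).const_mul a).add ((integrable_put hm t).const_mul b)) fun x => ?_
  have h1 := mul_le_mul_of_nonneg_left (le_max_left (s - x) 0) ha
  have h2 := mul_le_mul_of_nonneg_left (le_max_left (t - x) 0) hb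
  refine max_le ?_ (by positivity)
  have : a * s + b * t - x = a * (s - x) + b * (t - x) := by linear_combination x * hab
  linarith

lemma integral_put_eq_of_null {m : Measure ℝ} [IsFiniteMeasure m]
    (hm : Integrable (fun x => x) m) {a y t : ℝ} (h0 : m (Ioo a y) = 0) (hat : a ≤ t)
    (hty : t ≤ y) :
    ∫ x, max (t - x) 0 ∂m = ∫ x, max (a - x) 0 ∂m + (t - a) * m.real (Iic a) := by
  have hind : Integrable ((Iic a).indicator fun _ => t - a) m :=
    (integrable_const _).indicator measurableSet_Iic
  have : ∫ x, (Iic a).indicator (fun _ => t - a) x ∂m = (t - a) * m.real (Iic a) := by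
    rw [integral_indicator_const _ measurableSet_Iic, smul_eq_mul, mul_comm]
  rw [← this, ← integral_add (integrable_put hm a) hind]
  refine integral_congr_ae ?_
  filter_upwards [measure_eq_zero_iff_ae_notMem.1 h0] with x hx
  rcases le_or_gt x a with h | h
  · rw [indicator_of_mem (mem_Iic.2 h), max_eq_left (by linarith), max_eq_left (by linarith)]
    ring
  · have : y ≤ x := by
      by_contra! h'
      exact hx ⟨h, h'⟩
    rw [indicator_of_notMem (by simpa using h), max_eq_right (by linarith),
      max_eq_right (by linarith), add_zero]

lemma mul_measureReal_Iic_le_put_sub {m : Measure ℝ} [IsFiniteMeasure m]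
    (hm : Integrable (fun x => x) m) {s a : ℝ} (hsa : s ≤ a) :
    (a - s) * m.real (Iic s) ≤ ∫ x, max (a - x) 0 ∂m - ∫ x, max (s - x) 0 ∂m := by
  have : ∫ x, (Iic s).indicator (fun _ => a - s) x ∂m = (a - s) * m.real (Iic s) := by
    rw [integral_indicator_const _ measurableSet_Iic, smul_eq_mul, mul_comm]
  rw [← this, ← integral_sub (integrable_put hm a) (integrable_put hm s)]
  refine integral_mono ((integrable_const _).indicator measurableSet_Iic)
    ((integrable_put hm a).sub (integrable_put hm s)) fun x => ?_
  dsimp only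
  rcases le_or_gt x s with h | h
  · rw [indicator_of_mem (mem_Iic.2 h), max_eq_left (by linarith), max_eq_left (by linarith)]
    linarith
  · rw [indicator_of_notMem (by simpa using h), max_eq_right (b := (0 : ℝ)) (a := s - x) (by linarith)]
    simp

lemma exists_measure_Ico_pos_of_Iio {m : Measure ℝ} {y : ℝ} (h : m (Iio y) ≠ 0) :
    ∃ a, 0 < m (Ico a y) := by
  by_contra! hc
  refine h (measure_mono_null (t := ⋃ q : ℚ, Ico (q : ℝ) y) (fun x hx => ?_)
    (measure_iUnion_null fun q => nonpos_iff_eq_zero.1 (hc q)))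
  obtain ⟨q, hq⟩ := exists_rat_lt x
  exact mem_iUnion.2 ⟨q, hq.le, hx⟩

lemma exists_measure_Ico_pos_of_Ioo {m : Measure ℝ} {b y : ℝ} (h : m (Ioo b y) ≠ 0) :
    ∃ a, b < a ∧ 0 < m (Ico a y) := by
  by_contra! hc
  refine h (measure_mono_null (t := ⋃ q : ℚ, ⋃ _ : b < q, Ico (q : ℝ) y) (fun x hx => ?_)
    (measure_iUnion_null fun q => measure_iUnion_null fun hq => nonpos_iff_eq_zero.1 (hc q hq)))
  obtain ⟨q, hq, hqx⟩ := exists_rat_btwn hx.1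
  exact mem_iUnion₂.2 ⟨q, hq, hqx.le, hx.2⟩

lemma convexOn_three {f : ℝ → ℝ} (hf : ConvexOn ℝ univ f) {a t y : ℝ} (hat : a ≤ t)
    (hty : t ≤ y) : f t * (y - a) ≤ (y - t) * f a + (t - a) * f y := by
  rcases hat.eq_or_lt with rfl | hat
  · linarith
  rcases hty.eq_or_lt with rfl | hty
  · linarith
  have := hf.slope_mono_adjacent (mem_univ a) (mem_univ y) hat hty
  rw [div_le_div_iff₀ (by linarith) (by linarith)] at this
  linarith

/-- If the put potential of `η` dominates that of `μ`, strictly at `y`, then below the difference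
there is a wedge ending at `y` whose base carries mass of `η`. -/
lemma exists_wedge {μ η : Measure ℝ} [IsFiniteMeasure μ] [IsFiniteMeasure η]
    (hμ : Integrable (fun x => x) μ) (hη : Integrable (fun x => x) η) {y : ℝ}
    (hle : ∀ t, ∫ x, max (t - x) 0 ∂μ ≤ ∫ x, max (t - x) 0 ∂η)
    (hlt : ∫ x, max (y - x) 0 ∂μ < ∫ x, max (y - x) 0 ∂η) :
    ∃ a k : ℝ, 0 < k ∧ 0 < η (Ico a y) ∧
      ∀ t ∈ Icc a y, k * (t - a) ≤ ∫ x, max (t - x) 0 ∂η - ∫ x, max (t - x) 0 ∂μ := by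
  have hcμ := continuous_of_convexOn_univ (convexOn_put hμ)
  have hcη := continuous_of_convexOn_univ (convexOn_put hη)
  have hxμ := convexOn_put hμ
  have hnull : ∀ {a t : ℝ}, η (Ioo a y) = 0 → a ≤ t → t ≤ y → _ :=
    fun h h1 h2 => integral_put_eq_of_null hη h h1 h2
  have hsl : ∀ {s a : ℝ}, s ≤ a → _ := fun h => mul_measureReal_Iic_le_put_sub hη h
  have hpos : η (Iio y) ≠ 0 := by
    intro h0
    have : ∫ x, max (y - x) 0 ∂η = 0 := by
      refine integral_eq_zero_of_ae ?_
      filter_upwards [measure_eq_zero_iff_ae_notMem.1 h0] with x hx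
      exact max_eq_right (by simp at hx; linarith)
    exact (hlt.trans_eq this).not_ge (integral_nonneg fun _ => le_max_right _ _)
  set F : ℝ → ℝ := fun t => ∫ x, max (t - x) 0 ∂μ
  set G : ℝ → ℝ := fun t => ∫ x, max (t - x) 0 ∂η
  have hle' : ∀ t, F t ≤ G t := hle
  have hlt' : F y < G y := hlt
  change ∃ a k : ℝ, 0 < k ∧ 0 < η (Ico a y) ∧ ∀ t ∈ Icc a y, k * (t - a) ≤ G t - F t
  by_cases h : ∃ a, 0 < η (Ico a y) ∧ ∀ t ∈ Icc a y, 0 < G t - F t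
  · obtain ⟨a, ha, hD⟩ := h
    have hay : a < y := by
      by_contra! h
      simp [Ico_eq_empty_of_le h] at ha
    obtain ⟨t₀, ht₀, hmin⟩ := isCompact_Icc.exists_isMinOn (nonempty_Icc.2 hay.le)
      (hcη.sub hcμ).continuousOn
    have hε := hD t₀ ht₀
    refine ⟨a, (G t₀ - F t₀) / (y - a), div_pos hε (by linarith), ha, fun t ht => ?_⟩
    have h1 : G t₀ - F t₀ ≤ G t - F t := hmin ht
    refine le_trans ?_ h1
    rw [div_mul_eq_mul_div, div_le_iff₀ (by linarith)]
    nlinarith [ht.2]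
  push Not at h
  set Z := {t | t ≤ y ∧ G t - F t ≤ 0} with hZ
  have hZc : IsClosed Z := isClosed_Iic.inter (isClosed_le (hcη.sub hcμ) continuous_const)
  have hZb : BddAbove Z := ⟨y, fun t ht => ht.1⟩
  have hZn : Z.Nonempty := by
    obtain ⟨a₀, ha₀⟩ := exists_measure_Ico_pos_of_Iio hpos
    obtain ⟨t, ht, hDt⟩ := h a₀ ha₀
    exact ⟨t, ht.2, hDt⟩
  set a := sSup Z
  have haZ : a ∈ Z := hZc.csSup_mem hZn hZb
  have hay : a < y := lt_of_le_of_ne haZ.1 fun h => by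
    have := haZ.2
    rw [h] at this
    linarith
  have h0 : η (Ioo a y) = 0 := by
    by_contra h1
    obtain ⟨q, hq, hqm⟩ := exists_measure_Ico_pos_of_Ioo h1
    obtain ⟨t, ht, hDt⟩ := h q hqm
    have := le_csSup hZb (show t ∈ Z from ⟨ht.2, hDt⟩)
    linarith [ht.1]
  have hG : ∀ t, a ≤ t → t ≤ y → G t = G a + (t - a) * η.real (Iic a) :=
    fun t h1 h2 => hnull h0 h1 h2
  have hGF : G a = F a := le_antisymm (by linarith [haZ.2]) (hle' a)
  refine ⟨a, (G y - F y) / (y - a), div_pos (by linarith) (by linarith), ?_, fun t ht => ?_⟩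
  · by_contra! hn
    have hIco : η (Ico a y) = 0 := nonpos_iff_eq_zero.1 hn
    have hs : ∀ s < a, (y - a) * η.real (Iic s) ≤ F y - F a := by
      intro s hs
      have h1 : (a - s) * η.real (Iic s) ≤ G a - G s := hsl hs.le
      have h2 := convexOn_three hxμ hs.le hay.le
      change F a * (y - s) ≤ (y - a) * F s + (a - s) * F y at h2
      have h3 := hle' s
      have h4 : (a - s) * η.real (Iic s) * (y - a) ≤ (F a - F s) * (y - a) :=
        mul_le_mul_of_nonneg_right (by linarith) (by linarith)
      have h5 : (a - s) * ((y - a) * η.real (Iic s)) ≤ (a - s) * (F y - F a) := by linarith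
      exact le_of_mul_le_mul_left h5 (by linarith)
    obtain ⟨u, hum, hu, hut⟩ := exists_seq_strictMono_tendsto a
    have hlim : Tendsto (fun n => η.real (Iic (u n))) atTop (nhds (η.real (Iio a))) := by
      rw [← iUnion_Iic_eq_Iio_of_lt_of_tendsto hu hut]
      exact (ENNReal.tendsto_toReal (measure_ne_top _ _)).comp
        (tendsto_measure_iUnion_atTop fun i j hij => Iic_subset_Iic.2 (hum.monotone hij))
    have h1 : (y - a) * η.real (Iio a) ≤ F y - F a :=
      le_of_tendsto' (hlim.const_mul _) fun n => hs _ (hu n)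
    have h2 : η.real (Iic a) ≤ η.real (Iio a) := by
      have : η (Iic a) ≤ η (Iio a) := by
        rw [← Iio_union_right]
        refine (measure_union_le _ _).trans ?_
        rw [measure_mono_null (singleton_subset_iff.2 (left_mem_Ico.2 hay)) hIco, add_zero]
      exact ENNReal.toReal_mono (measure_ne_top _ _) this
    have h3 := hG y hay.le le_rfl
    nlinarith
  · have h1 := convexOn_three hxμ ht.1 ht.2
    change F t * (y - a) ≤ (y - t) * F a + (t - a) * F y at h1
    have h2 := hG t ht.1 ht.2
    have h3 := hG y hay.le le_rfl
    rw [div_mul_eq_mul_div, div_le_iff₀ (by linarith), h2, h3, hGF]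
    rw [h3, hGF] at *
    nlinarith

lemma leC.measureReal_univ_eq {μ η : Measure ℝ} [IsFiniteMeasure μ] [IsFiniteMeasure η]
    (h : leC μ η) : μ.real univ = η.real univ := by
  have hl : ∀ c : ℝ, LinGrowth fun _ => c := fun c =>
    ⟨|c|, fun x => by nlinarith [abs_nonneg c, abs_nonneg x]⟩
  have h1 := h (fun _ => 1) (hl 1) (convexOn_const _ convex_univ)
  have h2 := h (fun _ => -1) (hl (-1)) (convexOn_const _ convex_univ)
  simp only [integral_const, smul_eq_mul, mul_one, mul_neg] at h1 h2
  linarith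

lemma leC.integral_id_eq {μ η : Measure ℝ} (h : leC μ η) : ∫ x, x ∂μ = ∫ x, x ∂η := by
  have h1 := h (fun x => x) ⟨1, fun x => by linarith⟩ (convexOn_id convex_univ)
  have h2 : ∫ x, -x ∂μ ≤ ∫ x, -x ∂η :=
    h (fun x => -x) ⟨1, fun x => by rw [abs_neg]; linarith⟩ (concaveOn_id convex_univ).neg
  rw [integral_neg, integral_neg] at h2
  linarith

/-- A mass- and mean-preserving replacement of a part `ρ` of the shadow by a part `σ` of the unused
mass that stays above `μ` in convex order does not decrease the call potential. -/
lemma IsShadow.hinge_le_of_replacement {μ ν η ρ σ : Measure ℝ} [IsFiniteMeasure μ]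
    [IsFiniteMeasure ν] [IsFiniteMeasure η] (hμ : Integrable (fun x => x) μ)
    (hν : Integrable (fun x => x) ν) (hsh : IsShadow μ ν η) (hρ : ρ ≤ η) (hσ : σ ≤ ν - η)
    (hmass : ρ.real univ = σ.real univ) (hmean : ∫ x, x ∂ρ = ∫ x, x ∂σ)
    (hpot : ∀ t, ∫ x, max (x - t) 0 ∂ρ - ∫ x, max (x - t) 0 ∂σ
      ≤ ∫ x, max (x - t) 0 ∂η - ∫ x, max (x - t) 0 ∂μ) (t : ℝ) :
    ∫ x, max (x - t) 0 ∂ρ ≤ ∫ x, max (x - t) 0 ∂σ := by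
  obtain ⟨hC, hην, hmin⟩ := hsh
  have : IsFiniteMeasure ρ := isFiniteMeasure_of_le η hρ
  have hσν : σ ≤ ν := hσ.trans Measure.sub_le
  have : IsFiniteMeasure σ := isFiniteMeasure_of_le ν hσν
  have hη := hν.mono_measure hην
  set η' := (η - ρ) + σ with hη'
  have hle : η' ≤ ν := by
    calc η' ≤ η + (ν - η) := add_le_add Measure.sub_le hσ
      _ = ν := by rw [add_comm]; exact Measure.sub_add_cancel_of_le hην
  have : IsFiniteMeasure η' := isFiniteMeasure_of_le ν hle
  have hint : ∀ f : ℝ → ℝ, Integrable f ν →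
      ∫ x, f x ∂η' = ∫ x, f x ∂η - ∫ x, f x ∂ρ + ∫ x, f x ∂σ := by
    intro f hf
    have hfη := hf.mono_measure hην
    have h1 := integral_add_measure (hfη.mono_measure (Measure.sub_le (μ := η) (ν := ρ)))
      (hfη.mono_measure hρ)
    rw [Measure.sub_add_cancel_of_le hρ] at h1
    rw [hη', integral_add_measure (hfη.mono_measure Measure.sub_le) (hf.mono_measure hσν)]
    linarith
  have hconv : leC μ η' := by
    refine leC_of_hinge_le hμ (hν.mono_measure hle) ?_ ?_ fun t => ?_
    · have := hint (fun _ => 1) (integrable_const _)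
      simp only [integral_const, smul_eq_mul, mul_one] at this
      rw [this, hC.measureReal_univ_eq, hmass]
      ring
    · rw [hint _ hν, hC.integral_id_eq, hmean]
      ring
    · rw [hint _ (integrable_hinge hν t)]
      linarith [hpot t]
  have := hmin η' hconv hle _ (linGrowth_hinge t) (convexOn_hinge t)
  rw [hint _ (integrable_hinge hν t)] at this
  linarith

lemma measure_Ioi_eq_zero_of_isLUB {μ : Measure ℝ} {y : ℝ} (hy : IsLUB (mSupport μ) y) :
    μ (Ioi y) = 0 := by
  refine measure_null_of_locally_null _ fun x hx => ?_
  have hxs : x ∉ mSupport μ := fun h => (hy.1 h).not_gt hx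
  simp only [mSupport, mem_ofPred_eq, not_forall, not_not] at hxs
  obtain ⟨U, hU, h0⟩ := hxs
  exact ⟨U, mem_nhdsWithin_of_mem_nhds hU, h0⟩

lemma setIntegral_pos_of_pos {m : Measure ℝ} {s : Set ℝ} (hs : MeasurableSet s)
    (hm : m s ≠ 0) {f : ℝ → ℝ} (hf : IntegrableOn f s m) (hpos : ∀ x ∈ s, 0 < f x) :
    0 < ∫ x in s, f x ∂m := by
  rw [setIntegral_pos_iff_support_of_nonneg_ae
    ((ae_restrict_iff' hs).2 (ae_of_all _ fun x hx => (hpos x hx).le)) hf]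
  have : Function.support f ∩ s = s := inter_eq_right.2 fun x hx => (hpos x hx).ne'
  rw [this]
  exact pos_iff_ne_zero.2 hm

/-- To the right of the support of `μ`, the shadow uses all the mass of `ν` up to any level
beyond which it still has mass. -/
lemma IsShadow.sub_Icc_eq_zero {μ ν η : Measure ℝ} [IsFiniteMeasure μ] [IsFiniteMeasure ν]
    [IsFiniteMeasure η] (hμ : Integrable (fun x => x) μ) (hν : Integrable (fun x => x) ν)
    (hsh : IsShadow μ ν η) {y z : ℝ} (hμy : μ (Ioi y) = 0) (hyz : y ≤ z)
    (hz : η (Ioi z) ≠ 0) : (ν - η) (Icc y z) = 0 := by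
  by_contra hK
  have hην := hsh.2.1
  have hη := hν.mono_measure hην
  have hmass := hsh.1.measureReal_univ_eq
  have hmean := hsh.1.integral_id_eq
  set ζ := ν - η
  have hζν : ζ ≤ ν := Measure.sub_le
  have : IsFiniteMeasure ζ := isFiniteMeasure_of_le ν hζν
  have hζ := hν.mono_measure hζν
  have hCμ : ∀ t, y ≤ t → ∫ x, max (x - t) 0 ∂μ = 0 := by
    intro t ht
    refine integral_eq_zero_of_ae ?_
    filter_upwards [measure_eq_zero_iff_ae_notMem.1 hμy] with x hx
    exact max_eq_right (by simp at hx; linarith)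
  have hCz : ∀ t ≤ z, 0 < ∫ x in Ioi z, max (x - t) 0 ∂η := fun t ht =>
    setIntegral_pos_of_pos measurableSet_Ioi hz (integrable_hinge hη t).integrableOn
      fun x hx => lt_max_of_lt_left (by rw [mem_Ioi] at hx; linarith)
  have hCle : ∀ t, ∫ x, max (x - t) 0 ∂μ ≤ ∫ x, max (x - t) 0 ∂η := fun t =>
    hsh.1 _ (linGrowth_hinge t) (convexOn_hinge t)
  have hput : ∀ t, ∫ x, max (t - x) 0 ∂η - ∫ x, max (t - x) 0 ∂μ
      = ∫ x, max (x - t) 0 ∂η - ∫ x, max (x - t) 0 ∂μ := by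
    intro t
    rw [integral_put hη, integral_put hμ, hmass, hmean]
    ring
  have hCy : 0 < ∫ x, max (x - y) 0 ∂η := (hCz y hyz).trans_le
    (setIntegral_le_integral (integrable_hinge hη y) (ae_of_all _ fun _ => le_max_right _ _))
  obtain ⟨a, k, hk, hA, hwedge⟩ := exists_wedge hμ hη
    (fun t => by linarith [hput t, hCle t])
    (show ∫ x, max (y - x) 0 ∂μ < ∫ x, max (y - x) 0 ∂η by linarith [hput y, hCμ y le_rfl])
  set A := Ico a y
  set R := Ioi z
  set K := Icc y z
  have mA : MeasurableSet A := measurableSet_Ico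
  have mR : MeasurableSet R := measurableSet_Ioi
  have mK : MeasurableSet K := measurableSet_Icc
  set α := η.real A
  set β := η.real R
  set κ := ζ.real K
  have hα : 0 < α := ENNReal.toReal_pos hA.ne' (measure_ne_top _ _)
  have hβ : 0 < β := ENNReal.toReal_pos hz (measure_ne_top _ _)
  have hκ : 0 < κ := ENNReal.toReal_pos hK (measure_ne_top _ _)
  have hyη : Integrable (fun x => x - y) η := hη.sub (integrable_const y)
  have hyη' : Integrable (fun x => y - x) η := (integrable_const y).sub hη
  have hyζ : Integrable (fun x => x - y) ζ := hζ.sub (integrable_const y)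
  set MA := ∫ x in A, (y - x) ∂η with hMA
  set MR := ∫ x in R, (x - y) ∂η with hMR
  set MK := ∫ x in K, (x - y) ∂ζ with hMK
  have hMApos : 0 < MA := setIntegral_pos_of_pos mA hA.ne' hyη'.integrableOn
    fun x hx => by linarith [hx.2]
  have hMKnn : 0 ≤ MK := setIntegral_nonneg mK fun x hx => by linarith [hx.1]
  have hMKle : MK ≤ (z - y) * κ := by
    have : MK ≤ ∫ x in K, (z - y) ∂ζ := setIntegral_mono_on hyζ.integrableOn
      (integrable_const _).integrableOn mK fun x hx => by linarith [hx.2]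
    rwa [setIntegral_const, smul_eq_mul, mul_comm] at this
  have hMRle : (z - y) * β ≤ MR := by
    have : ∫ x in R, (z - y) ∂η ≤ MR := setIntegral_mono_on
      (integrable_const _).integrableOn hyη.integrableOn mR fun x hx => by
        have := mem_Ioi.1 hx
        linarith
    rwa [setIntegral_const, smul_eq_mul, mul_comm] at this
  have hMRnn : 0 ≤ MR := le_trans (by nlinarith) hMRle
  obtain ⟨l, r, s, hr0, hl1, hr1, hs1, hlk, hbal, hbar⟩ : ∃ l r s : NNReal, 0 < r ∧ l ≤ 1 ∧
      r ≤ 1 ∧ s ≤ 1 ∧ l * α ≤ k ∧ l * α + r * β = s * κ ∧ -(l * MA) + r * MR = s * MK := by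
    set l₀ := κ * MR - MK * β with hl₀
    set r₀ := α * MK + κ * MA with hr₀
    set s₀ := α * MR + β * MA with hs₀
    have hl : 0 ≤ l₀ := by nlinarith
    have hr : 0 < r₀ := by positivity
    have hs : 0 ≤ s₀ := by positivity
    set T := l₀ + r₀ + s₀ + l₀ * α / k + 1 with hT
    have hq : 0 ≤ l₀ * α / k := by positivity
    have hTpos : 0 < T := by positivity
    refine ⟨⟨l₀ / T, by positivity⟩, ⟨r₀ / T, by positivity⟩, ⟨s₀ / T, by positivity⟩,
      ?_, ?_, ?_, ?_, ?_, ?_, ?_⟩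
    · exact NNReal.coe_pos.1 (show 0 < r₀ / T by positivity)
    · exact NNReal.coe_le_coe.1 (show l₀ / T ≤ 1 by rw [div_le_one hTpos]; linarith)
    · exact NNReal.coe_le_coe.1 (show r₀ / T ≤ 1 by rw [div_le_one hTpos]; linarith)
    · exact NNReal.coe_le_coe.1 (show s₀ / T ≤ 1 by rw [div_le_one hTpos]; linarith)
    · change l₀ / T * α ≤ k
      rw [div_mul_eq_mul_div, div_le_iff₀ hTpos, mul_comm k, ← div_le_iff₀ hk]
      linarith
    · change l₀ / T * α + r₀ / T * β = s₀ / T * κ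
      rw [hl₀, hr₀, hs₀]
      ring
    · change -(l₀ / T * MA) + r₀ / T * MR = s₀ / T * MK
      rw [hl₀, hr₀, hs₀]
      ring
  set ρ : Measure ℝ := l • η.restrict A + r • η.restrict R with hρ
  set σ : Measure ℝ := s • ζ.restrict K with hσ
  have hsmul : ∀ (c : NNReal) (m : Measure ℝ), c ≤ 1 → c • m ≤ m := fun c m hc => by
    refine Measure.le_iff.2 fun u _ => ?_
    rw [Measure.smul_apply]
    exact mul_le_of_le_one_left (zero_le) (by exact_mod_cast hc)
  have hρη : ρ ≤ η := by
    have hdisj : Disjoint A R := Set.disjoint_left.2 fun x hx hx' =>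
      absurd (mem_Ioi.1 hx') (by linarith [hx.2])
    calc ρ ≤ η.restrict A + η.restrict R := add_le_add (hsmul _ _ hl1) (hsmul _ _ hr1)
      _ = η.restrict (A ∪ R) := (Measure.restrict_union hdisj mR).symm
      _ ≤ η := Measure.restrict_le_self
  have hσζ : σ ≤ ζ := (hsmul _ _ hs1).trans Measure.restrict_le_self
  have : IsFiniteMeasure ρ := isFiniteMeasure_of_le η hρη
  have : IsFiniteMeasure σ := isFiniteMeasure_of_le ζ hσζ
  have hintρ : ∀ f : ℝ → ℝ, Integrable f η →
      ∫ x, f x ∂ρ = l * ∫ x in A, f x ∂η + r * ∫ x in R, f x ∂η := by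
    intro f hf
    rw [hρ, integral_add_measure, integral_smul_nnreal_measure, integral_smul_nnreal_measure]
    · simp [NNReal.smul_def]
    · exact (hf.mono_measure Measure.restrict_le_self).mono_measure (hsmul _ _ hl1)
    · exact (hf.mono_measure Measure.restrict_le_self).mono_measure (hsmul _ _ hr1)
  have hintσ : ∀ f : ℝ → ℝ, ∫ x, f x ∂σ = s * ∫ x in K, f x ∂ζ := by
    intro f
    rw [hσ, integral_smul_nnreal_measure]
    simp [NNReal.smul_def]
  have hmassρσ : ρ.real univ = σ.real univ := by
    have h1 := hintρ (fun _ => 1) (integrable_const _)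
    have h2 := hintσ fun _ => 1
    simp only [integral_const, measureReal_restrict_apply MeasurableSet.univ, univ_inter,
      smul_eq_mul, mul_one] at h1 h2
    rw [h1, h2]
    exact hbal
  have hmeanρσ : ∫ x, x ∂ρ = ∫ x, x ∂σ := by
    have h1 : MA = y * α - ∫ x in A, x ∂η := by
      rw [hMA, integral_sub (integrable_const _) hη.integrableOn, setIntegral_const, smul_eq_mul,
        mul_comm]
    have h2 : MR = ∫ x in R, x ∂η - y * β := by
      rw [hMR, integral_sub hη.integrableOn (integrable_const _), setIntegral_const, smul_eq_mul,
        mul_comm]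
    have h3 : MK = ∫ x in K, x ∂ζ - y * κ := by
      rw [hMK, integral_sub hζ.integrableOn (integrable_const _), setIntegral_const, smul_eq_mul,
        mul_comm]
    rw [hintρ _ hη, hintσ]
    rw [h1, h2, h3] at hbar
    linear_combination hbar + y * hbal
  have hpot : ∀ t, ∫ x, max (x - t) 0 ∂ρ - ∫ x, max (x - t) 0 ∂σ
      ≤ ∫ x, max (x - t) 0 ∂η - ∫ x, max (x - t) 0 ∂μ := by
    intro t
    rcases le_or_gt y t with ht | ht
    · rw [hCμ t ht]
      have h1 : ∫ x, max (x - t) 0 ∂ρ ≤ ∫ x, max (x - t) 0 ∂η := integral_mono_measure hρη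
        (ae_of_all _ fun _ => le_max_right _ _) (integrable_hinge hη t)
      have h2 : 0 ≤ ∫ x, max (x - t) 0 ∂σ := integral_nonneg fun _ => le_max_right _ _
      linarith
    · have hpρ := integral_put (hη.mono_measure hρη) t
      have hpσ := integral_put (hζ.mono_measure hσζ) t
      have h0 : 0 ≤ ∫ x, max (t - x) 0 ∂σ := integral_nonneg fun _ => le_max_right _ _
      have hR : ∫ x in R, max (t - x) 0 ∂η = 0 := setIntegral_eq_zero_of_forall_eq_zero
        fun x hx => max_eq_right (by have := mem_Ioi.1 hx; linarith)
      have hA' : ∫ x in A, max (t - x) 0 ∂η ≤ max (t - a) 0 * α := by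
        have : ∫ x in A, max (t - x) 0 ∂η ≤ ∫ x in A, max (t - a) 0 ∂η :=
          setIntegral_mono_on (integrable_put hη t).integrableOn (integrable_const _).integrableOn
            mA fun x hx => max_le_max_right _ (by linarith [hx.1])
        rwa [setIntegral_const, smul_eq_mul, mul_comm] at this
      have h1 := hintρ _ (integrable_put hη t)
      rw [hR, mul_zero, add_zero] at h1
      have h2 : l * ∫ x in A, max (t - x) 0 ∂η ≤ k * max (t - a) 0 := by
        refine (mul_le_mul_of_nonneg_left hA' l.2).trans ?_
        rw [mul_comm (max _ _), ← mul_assoc]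
        exact mul_le_mul_of_nonneg_right hlk (le_max_right _ _)
      have h3 : k * max (t - a) 0 ≤ ∫ x, max (x - t) 0 ∂η - ∫ x, max (x - t) 0 ∂μ := by
        rcases le_total a t with hat | hat
        · rw [max_eq_left (by linarith), ← hput]
          exact hwedge t ⟨hat, ht.le⟩
        · rw [max_eq_right (by linarith), mul_zero]
          linarith [hCle t]
      rw [hmassρσ, hmeanρσ] at hpρ
      linarith
  have hfin := hsh.hinge_le_of_replacement hμ hν hρη hσζ hmassρσ hmeanρσ hpot z
  rw [hintρ _ (integrable_hinge hη z), hintσ] at hfin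
  have h1 : ∫ x in K, max (x - z) 0 ∂ζ = 0 := setIntegral_eq_zero_of_forall_eq_zero
    fun x hx => max_eq_right (by linarith [hx.2])
  have h2 : 0 ≤ l * ∫ x in A, max (x - z) 0 ∂η :=
    mul_nonneg l.2 (integral_nonneg fun _ => le_max_right _ _)
  have h3 : 0 < r * ∫ x in R, max (x - z) 0 ∂η := mul_pos hr0 (hCz z le_rfl)
  rw [h1, mul_zero] at hfin
  linarith

lemma posPartSub_eq_sub (η μ : Measure ℝ) [IsFiniteMeasure η] [IsFiniteMeasure μ] :
    posPartSub η μ = η - μ := by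
  rw [posPartSub, Measure.toJordanDecomposition_toSignedMeasure_sub,
    Measure.jordanDecompositionOfToSignedMeasureSub_posPart]

/-- If `θ₀` dominates `θ` below `c`, has no mass above `c`, and has the same total mass as `θ`,
then `θ₀` is stochastically smaller than `θ`. -/
lemma integral_le_of_restrict_Iio_le {θ₀ θ : Measure ℝ} [IsFiniteMeasure θ₀] [IsFiniteMeasure θ]
    {c : ℝ} (hIio : θ.restrict (Iio c) ≤ θ₀.restrict (Iio c)) (hIoi : θ₀ (Ioi c) = 0)
    (hmass : θ univ = θ₀ univ) {φ : ℝ → ℝ} (hφ : Monotone φ) (h₀ : Integrable φ θ₀)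
    (h : Integrable φ θ) : ∫ x, φ x ∂θ₀ ≤ ∫ x, φ x ∂θ := by
  have hg₀ : Integrable (fun x => φ c - φ x) θ₀ := (integrable_const _).sub h₀
  have hg : Integrable (fun x => φ c - φ x) θ := (integrable_const _).sub h
  have e : ∀ (m : Measure ℝ) [IsFiniteMeasure m], Integrable φ m →
      ∫ x, (φ c - φ x) ∂m = m.real univ * φ c - ∫ x, φ x ∂m := by
    intro m _ hm
    rw [integral_sub (integrable_const _) hm, integral_const, smul_eq_mul]
  have hlow : ∫ x in Iio c, (φ c - φ x) ∂θ ≤ ∫ x in Iio c, (φ c - φ x) ∂θ₀ :=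
    integral_mono_measure hIio ((ae_restrict_iff' measurableSet_Iio).2
      (ae_of_all _ fun x hx => sub_nonneg.2 (hφ (mem_Iio.1 hx).le))) hg₀.integrableOn
  have hup : ∫ x in (Iio c)ᶜ, (φ c - φ x) ∂θ ≤ 0 :=
    setIntegral_nonpos measurableSet_Iio.compl fun x hx =>
      sub_nonpos.2 (hφ (by simpa using hx))
  have hup₀ : ∫ x in (Iio c)ᶜ, (φ c - φ x) ∂θ₀ = 0 := by
    refine integral_eq_zero_of_ae ((ae_restrict_iff' measurableSet_Iio.compl).2 ?_)
    filter_upwards [measure_eq_zero_iff_ae_notMem.1 hIoi] with x hx hx'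
    have : x = c := le_antisymm (by simpa using hx) (by simpa using hx')
    simp [this]
  have h1 := integral_add_compl measurableSet_Iio hg₀ (s := Iio c)
  have h2 := integral_add_compl measurableSet_Iio hg (s := Iio c)
  rw [e θ₀ h₀] at h1
  rw [e θ h] at h2
  have : θ.real univ = θ₀.real univ := by rw [measureReal_def, hmass, measureReal_def]
  rw [this] at h2
  linarith

/-- Either the shadow exhausts `ν` on `[y, ∞)`, or it exhausts `ν` up to a level above which it
has no mass. -/
lemma IsShadow.exists_level {μ ν η : Measure ℝ} [IsFiniteMeasure μ] [IsFiniteMeasure ν]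
    [IsFiniteMeasure η] (hμ : Integrable (fun x => x) μ) (hν : Integrable (fun x => x) ν)
    (hsh : IsShadow μ ν η) {y : ℝ} (hμy : μ (Ioi y) = 0) :
    (ν - η) (Ici y) = 0 ∨ ∃ c, (ν - η) (Ico y c) = 0 ∧ η (Ioi c) = 0 := by
  set S := {z | y ≤ z ∧ η (Ioi z) ≠ 0} with hS
  have hnull : ∀ z ∈ S, (ν - η) (Icc y z) = 0 := fun z hz =>
    hsh.sub_Icc_eq_zero hμ hν hμy hz.1 hz.2
  rcases S.eq_empty_or_nonempty with hE | hne
  · refine Or.inr ⟨y, by simp, ?_⟩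
    by_contra h
    exact (hE ▸ (show y ∈ S from ⟨le_rfl, h⟩) : y ∈ (∅ : Set ℝ))
  by_cases hb : BddAbove S
  · refine Or.inr ⟨sSup S, ?_, ?_⟩
    · refine measure_mono_null (t := ⋃ q : ℚ, ⋃ _ : (q : ℝ) < sSup S, Icc y q) (fun x hx => ?_)
        (measure_iUnion_null fun q => measure_iUnion_null fun hq => ?_)
      · obtain ⟨q, hxq, hq⟩ := exists_rat_btwn hx.2
        exact mem_iUnion₂.2 ⟨q, hq, hx.1, hxq.le⟩
      · obtain ⟨z, hz, hqz⟩ := exists_lt_of_lt_csSup hne hq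
        exact measure_mono_null (Icc_subset_Icc_right hqz.le) (hnull z hz)
    · refine measure_mono_null (t := ⋃ q : ℚ, ⋃ _ : sSup S < (q : ℝ), Ioi (q : ℝ))
        (fun x hx => ?_) (measure_iUnion_null fun q => measure_iUnion_null fun hq => ?_)
      · obtain ⟨q, hq, hqx⟩ := exists_rat_btwn (mem_Ioi.1 hx)
        exact mem_iUnion₂.2 ⟨q, hq, hqx⟩
      · by_contra h
        obtain ⟨z, hz⟩ := hne
        have hyq : y ≤ q := hz.1.trans ((le_csSup hb hz).trans hq.le)
        exact (le_csSup hb (show (q : ℝ) ∈ S from ⟨hyq, h⟩)).not_gt hq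
  · refine Or.inl (measure_mono_null (t := ⋃ n : ℕ, Icc y n) (fun x hx => ?_)
      (measure_iUnion_null fun n => ?_))
    · obtain ⟨n, hn⟩ := exists_nat_ge x
      exact mem_iUnion.2 ⟨n, hx, hn⟩
    · obtain ⟨z, hz, hnz⟩ := not_bddAbove_iff.1 hb n
      exact measure_mono_null (Icc_subset_Icc_right hnz.le) (hnull z hz)

lemma restrict_sub_eq_of_null {μ ν η : Measure ℝ} [IsFiniteMeasure μ] [IsFiniteMeasure ν]
    [IsFiniteMeasure η] (hην : η ≤ ν) {B : Set ℝ} (hB : MeasurableSet B)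
    (h0 : (ν - η) B = 0) : (ν - μ).restrict B = (η - μ).restrict B := by
  have : ν.restrict B = η.restrict B := by
    conv_lhs => rw [← Measure.sub_add_cancel_of_le hην]
    rw [Measure.restrict_add, Measure.restrict_eq_zero.2 h0, zero_add]
  rw [Measure.restrict_sub_eq_restrict_sub_restrict hB, this,
    ← Measure.restrict_sub_eq_restrict_sub_restrict hB]

/-- the tail of the shadow: `(S^ν(μ) − μ)₊` restricted to `[y,∞)` is the
stochastically leftmost measure of its mass dominated by `((ν − μ)₊)|_{[y,∞)}`. -/
theorem shadow_tail (μ ν : Measure ℝ) [IsFiniteMeasure μ] [IsFiniteMeasure ν]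
    (hμ : Integrable (fun x => x) μ) (hν : Integrable (fun x => x) ν)
    (hle : leCP μ ν) (y : ℝ) (hy : IsLUB (mSupport μ) y) :
    ∀ (η : Measure ℝ) [IsFiniteMeasure η], IsShadow μ ν η →
      ∀ θ : Measure ℝ, MemM θ →
        θ Set.univ = ((posPartSub η μ).restrict (Set.Ici y)) Set.univ →
        θ ≤ (posPartSub ν μ).restrict (Set.Ici y) →
        leSto ((posPartSub η μ).restrict (Set.Ici y)) θ := by
  intro η _ hsh θ hθ hmass hle' φ hl hφ
  rw [posPartSub_eq_sub] at hmass hle' ⊢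
  have hην := hsh.2.1
  have := hθ.1
  have hθ₀η : (η - μ).restrict (Ici y) ≤ η := Measure.restrict_le_self.trans Measure.sub_le
  have : IsFiniteMeasure ((η - μ).restrict (Ici y)) := isFiniteMeasure_of_le η hθ₀η
  have h₀ : Integrable φ ((η - μ).restrict (Ici y)) :=
    integrable_of_linGrowth (hν.mono_measure (hθ₀η.trans hην)) hl hφ.measurable
  have h : Integrable φ θ := integrable_of_linGrowth hθ.2 hl hφ.measurable
  rcases hsh.exists_level hμ hν (measure_Ioi_eq_zero_of_isLUB hy) with h0 | ⟨c, h0, hc⟩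
  · rw [restrict_sub_eq_of_null hην measurableSet_Ici h0] at hle'
    rw [Measure.eq_of_le_of_measure_univ_eq hle' hmass]
  · refine integral_le_of_restrict_Iio_le (c := c) ?_
      (nonpos_iff_eq_zero.1 ((hθ₀η _).trans_eq hc)) hmass hφ h₀ h
    refine (Measure.restrict_mono subset_rfl hle').trans_eq ?_
    have : Iio c ∩ Ici y = Ico y c := by rw [inter_comm, Ici_inter_Iio]
    rw [Measure.restrict_restrict measurableSet_Iio, Measure.restrict_restrict measurableSet_Iio,
      this, restrict_sub_eq_of_null hην measurableSet_Ico h0]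

end
end
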